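/- arXiv:2208.01181 — 8 statements merged into one kernel-verified Lean document; each statement's English description precedes it below -/
import Mathlib

section
/- Let n ≥ 1 and let u_1,…,u_{n²} be unitaries in M_n(ℂ) with (1/n)·Tr(u_j* u_i) = δ_{ij} for all i,j (a unitary error basis). Set P_i := (u_i* ⊗ 1_n)|ψ_n⟩⟨ψ_n|(u_i ⊗ 1_n) ∈ M_n(ℂ)⊗M_n(ℂ). Then: (a) the P_i are self-adjoint projections with P_i P_j = 0 for i ≠ j and Σ_{i=1}^{n²} P_i = 1; and (b) for every x ∈ M_n(ℂ), the teleportation identity x = Σ_{i=1}^{n²} Tr₂₃[(1_n ⊗ |ψ_n⟩⟨ψ_n|)(P_i ⊗ u_i x u_i*)] holds, where Tr₂₃ denotes the unnormalized partial trace over the second and third tensor factors of M_n(ℂ)⊗M_n(ℂ)⊗M_n(ℂ), i.e., (Tr₂₃ Z)_{a,b} = Σ_{c,e} Z_{(a,c,e),(b,c,e)}. -/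
open Matrix
open scoped Kronecker

/-- The maximally entangled unit vector `ψₙ = n^{-1/2} ∑ᵢ eᵢ ⊗ eᵢ ∈ ℂⁿ ⊗ ℂⁿ`. -/
noncomputable def psi (n : ℕ) : Fin n × Fin n → ℂ :=
  fun p => if p.1 = p.2 then (Real.sqrt n : ℂ)⁻¹ else 0

/-- The rank one projection `|ψₙ⟩⟨ψₙ| ∈ Mₙ(ℂ) ⊗ Mₙ(ℂ)`. -/
noncomputable def psiProj (n : ℕ) : Matrix (Fin n × Fin n) (Fin n × Fin n) ℂ :=
  vecMulVec (psi n) (star (psi n))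

/-- Reassociation `(Mₙ ⊗ Mₙ) ⊗ Mₙ ≃ Mₙ ⊗ (Mₙ ⊗ Mₙ)`. -/
def assoc3 (n : ℕ) (Z : Matrix ((Fin n × Fin n) × Fin n) ((Fin n × Fin n) × Fin n) ℂ) :
    Matrix (Fin n × Fin n × Fin n) (Fin n × Fin n × Fin n) ℂ :=
  Matrix.reindex (Equiv.prodAssoc (Fin n) (Fin n) (Fin n))
    (Equiv.prodAssoc (Fin n) (Fin n) (Fin n)) Z

/-- Unnormalized partial trace over the second and third tensor factors of
`Mₙ(ℂ) ⊗ Mₙ(ℂ) ⊗ Mₙ(ℂ)`. -/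
noncomputable def tr23 (n : ℕ)
    (Z : Matrix (Fin n × Fin n × Fin n) (Fin n × Fin n × Fin n) ℂ) :
    Matrix (Fin n) (Fin n) ℂ :=
  Matrix.of fun a b => ∑ c : Fin n, ∑ e : Fin n, Z (a, c, e) (b, c, e)

lemma sqrt_inv_mul_self (n : ℕ) : (Real.sqrt n : ℂ)⁻¹ * (Real.sqrt n : ℂ)⁻¹ = (n : ℂ)⁻¹ := by
  rw [← mul_inv, ← Complex.ofReal_mul, Real.mul_self_sqrt (Nat.cast_nonneg n)]
  simp

lemma psiProj_apply (n : ℕ) (a b c d : Fin n) :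
    psiProj n (a, b) (c, d) = if a = b then (if c = d then (n : ℂ)⁻¹ else 0) else 0 := by
  rw [← sqrt_inv_mul_self]
  by_cases h1 : a = b <;> by_cases h2 : c = d <;>
    simp [psiProj, psi, vecMulVec_apply, h1, h2]

lemma P_entry (n : ℕ) (w : Matrix (Fin n) (Fin n) ℂ) (a b c d : Fin n) :
    ((wᴴ ⊗ₖ (1 : Matrix (Fin n) (Fin n) ℂ)) * psiProj n *
        (w ⊗ₖ (1 : Matrix (Fin n) (Fin n) ℂ))) (a, b) (c, d)
      = (n : ℂ)⁻¹ * (star (w b a) * w d c) := by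
  simp only [Matrix.mul_apply, Fintype.sum_prod_type, psiProj_apply, kroneckerMap_apply,
    Matrix.one_apply, conjTranspose_apply]
  simp
  ring

/-- Standard quantum teleportation: if `u₁, …, u_{n²}` is a unitary error basis of `Mₙ(ℂ)`,
then the `Pᵢ = (uᵢ* ⊗ 1)|ψₙ⟩⟨ψₙ|(uᵢ ⊗ 1)` form a PVM, and the teleportation identity
`x = ∑ᵢ Tr₂₃[(1 ⊗ |ψₙ⟩⟨ψₙ|)(Pᵢ ⊗ uᵢ x uᵢ*)]` holds for every `x ∈ Mₙ(ℂ)`. -/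
theorem standard_teleportation (n : ℕ) (hn : 1 ≤ n)
    (u : Fin (n ^ 2) → Matrix (Fin n) (Fin n) ℂ)
    (hu : ∀ i, (u i)ᴴ * u i = 1)
    (horth : ∀ i j, (n : ℂ)⁻¹ * Matrix.trace ((u j)ᴴ * u i) = if i = j then 1 else 0)
    (P : Fin (n ^ 2) → Matrix (Fin n × Fin n) (Fin n × Fin n) ℂ)
    (hP : ∀ i, P i = ((u i)ᴴ ⊗ₖ (1 : Matrix (Fin n) (Fin n) ℂ)) * psiProj n *
        (u i ⊗ₖ (1 : Matrix (Fin n) (Fin n) ℂ))) :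
    ((∀ i, (P i)ᴴ = P i ∧ P i * P i = P i) ∧
      (∀ i j, i ≠ j → P i * P j = 0) ∧
      (∑ i, P i) = 1) ∧
    (∀ x : Matrix (Fin n) (Fin n) ℂ,
      x = ∑ i, tr23 n
        (((1 : Matrix (Fin n) (Fin n) ℂ) ⊗ₖ psiProj n) *
          assoc3 n (P i ⊗ₖ (u i * x * (u i)ᴴ)))) := by
  have hn0 : (n : ℂ) ≠ 0 := by
    exact_mod_cast (by omega : n ≠ 0)
  have hE : ∀ i a b c d, P i (a, b) (c, d) = (n : ℂ)⁻¹ * (star (u i b a) * u i d c) := by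
    intro i a b c d
    rw [hP, P_entry]
  have hO : ∀ i j, (n : ℂ)⁻¹ * ∑ c, ∑ d, u i d c * star (u j d c) = if i = j then 1 else 0 := by
    intro i j
    rw [← horth i j]
    simp only [Matrix.trace, Matrix.diag, Matrix.mul_apply, conjTranspose_apply]
    congr 1
    refine Finset.sum_congr rfl fun c _ => Finset.sum_congr rfl fun d _ => mul_comm _ _
  have hM : ∀ i j, P i * P j = if i = j then P i else 0 := by
    intro i j
    ext ⟨a, b⟩ ⟨c, d⟩
    have : (P i * P j) (a, b) (c, d) = (n : ℂ)⁻¹ * (star (u i b a) * u j d c) *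
        ((n : ℂ)⁻¹ * ∑ c, ∑ d, u i d c * star (u j d c)) := by
      simp only [Matrix.mul_apply, Fintype.sum_prod_type, hE, Finset.mul_sum]
      refine Finset.sum_congr rfl fun c _ => Finset.sum_congr rfl fun d _ => ?_
      ring
    rw [this, hO]
    split_ifs with h
    · subst h
      rw [hE, mul_one]
    · simp
  refine ⟨⟨fun i => ⟨?_, by simp [hM]⟩, fun i j h => by simp [hM, h], ?_⟩, ?_⟩
  · ext ⟨a, b⟩ ⟨c, d⟩
    rw [conjTranspose_apply, hE, hE]
    simp [mul_comm]
  · let V : Matrix (Fin n × Fin n) (Fin (n ^ 2)) ℂ :=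
      Matrix.of fun p i => (n : ℂ)⁻¹ * star (u i p.2 p.1)
    let W : Matrix (Fin (n ^ 2)) (Fin n × Fin n) ℂ := Matrix.of fun i p => u i p.2 p.1
    have hWV : W * V = 1 := by
      ext i j
      rw [Matrix.one_apply, ← hO i j]
      simp only [W, V, Matrix.mul_apply, Fintype.sum_prod_type, Matrix.of_apply, Finset.mul_sum]
      refine Finset.sum_congr rfl fun c _ => Finset.sum_congr rfl fun d _ => ?_
      ring
    have hVW : V * W = 1 :=
      (Matrix.mul_eq_one_comm_of_card_eq _ _ _ (by simp [sq])).mp hWV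
    rw [← hVW]
    ext ⟨a, b⟩ ⟨c, d⟩
    rw [Matrix.sum_apply, Matrix.mul_apply]
    refine Finset.sum_congr rfl fun i _ => ?_
    simp only [hE, V, W, Matrix.of_apply]
    ring
  · intro x
    have key : ∀ i, tr23 n (((1 : Matrix (Fin n) (Fin n) ℂ) ⊗ₖ psiProj n) *
          assoc3 n (P i ⊗ₖ (u i * x * (u i)ᴴ))) = ((n : ℂ)⁻¹ * (n : ℂ)⁻¹) • x := by
      intro i
      have hx : x = (u i)ᴴ * (u i * x * (u i)ᴴ) * u i := by
        calc x = ((u i)ᴴ * u i) * x * ((u i)ᴴ * u i) := by simp [hu]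
          _ = _ := by simp only [Matrix.mul_assoc]
      conv_rhs => rw [hx]
      generalize u i * x * (u i)ᴴ = y
      ext a b
      simp only [tr23, assoc3, Matrix.of_apply, Matrix.mul_apply, Fintype.sum_prod_type,
        kroneckerMap_apply, Matrix.one_apply, psiProj_apply, Matrix.reindex_apply,
        Matrix.submatrix_apply, Equiv.prodAssoc_symm_apply, hE, Matrix.smul_apply,
        conjTranspose_apply]
      simp [Finset.mul_sum, Finset.sum_mul]
      refine Finset.sum_congr rfl fun c _ => Finset.sum_congr rfl fun d _ => ?_
      ring
    simp only [key]
    rw [Finset.sum_const, Finset.card_univ, Fintype.card_fin, ← Nat.cast_smul_eq_nsmul ℂ, smul_smul]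
    have : ((n ^ 2 : ℕ) : ℂ) * ((n : ℂ)⁻¹ * (n : ℂ)⁻¹) = 1 := by
      push_cast
      field_simp
    rw [this, one_smul]
end

section
/- Let m ≥ 1, let n_1,…,n_m be positive integers, let A := Π_{j=1}^m M_{n_j}(ℂ), and let ι : A → M_n(ℂ) (n = Σ_j n_j) be the block-diagonal *-embedding. Let I be a finite index set and T_i : A → A (i ∈ I) linear maps with Σ_{i∈I} T_i = id_A, and suppose each T_i is completely positive in the sense that there is a finite family of matrices v_{i,k} ∈ M_n(ℂ) with ι(T_i(x)) = Σ_k v_{i,k}* · ι(x) · v_{i,k} for all x ∈ A. Then for every i ∈ I and every j ∈ {1,…,m} there exists a real number μ_i^j ≥ 0 such that (T_i(x))_j = μ_i^j · x_j for all x ∈ A; in particular each T_i is a nonnegative scalar multiple of the identity on each direct summand of A. -/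
open Matrix

theorem aux_block {m : ℕ} (nv : Fin m → ℕ) (j : Fin m) (p q : Fin (nv j)) :
    Matrix.blockDiagonal' (Pi.single j (Matrix.single p q (1 : ℂ)) :
      (j : Fin m) → Matrix (Fin (nv j)) (Fin (nv j)) ℂ) =
    Matrix.single (⟨j, p⟩ : (j : Fin m) × Fin (nv j)) ⟨j, q⟩ (1 : ℂ) := by
  ext ⟨a, a'⟩ ⟨b, b'⟩
  rw [Matrix.blockDiagonal'_apply]
  by_cases h : a = b
  · subst h
    by_cases h2 : j = a
    · subst h2
      simp [Matrix.single_apply]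
    · rw [Pi.single_eq_of_ne (Ne.symm h2)]
      simp [Matrix.single_apply, h2]
  · simp only [h, dite_false, Matrix.single_apply]
    rw [if_neg]
    rintro ⟨h1, h2⟩
    exact h ((congrArg Sigma.fst h1).symm.trans (congrArg Sigma.fst h2))

theorem aux_entry {N : Type*} [Fintype N] [DecidableEq N] (v : Matrix N N ℂ) (a b c d : N) :
    (vᴴ * Matrix.single a b (1 : ℂ) * v) c d = star (v a c) * v b d := by
  simp [Matrix.mul_apply, Matrix.single_apply, ite_and]

theorem aux_zero {S : Type*} [Fintype S] (f : S → ℂ) (h : ∑ s, star (f s) * f s = 0) (s : S) :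
    f s = 0 := by
  have h1 : ∑ s, Complex.normSq (f s) = 0 := by
    have : ((∑ s, Complex.normSq (f s) : ℝ) : ℂ) = 0 := by
      rw [← h]; push_cast
      exact Finset.sum_congr rfl fun s _ => Complex.normSq_eq_conj_mul_self
    exact_mod_cast this
  have := (Finset.sum_eq_zero_iff_of_nonneg (fun s _ => Complex.normSq_nonneg (f s))).1 h1 s
    (Finset.mem_univ s)
  exact Complex.normSq_eq_zero.1 this

/-- If `T_i : A → A` are completely positive maps on `A = Π_j M_{n_j}(ℂ)`
(complete positivity expressed via Kraus decompositions through the block-diagonal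
embedding `ι : A → Mₙ(ℂ)`), and `∑ᵢ Tᵢ = id`, then each `Tᵢ` acts on each direct
summand of `A` as a nonnegative scalar multiple of the identity. -/
theorem cp_summands_are_scalars (m : ℕ) (hm : 1 ≤ m)
    (nv : Fin m → ℕ) (hnv : ∀ j, 1 ≤ nv j)
    (I : Type) [Fintype I]
    (T : I → (((j : Fin m) → Matrix (Fin (nv j)) (Fin (nv j)) ℂ) →ₗ[ℂ]
              ((j : Fin m) → Matrix (Fin (nv j)) (Fin (nv j)) ℂ)))
    (hsum : (∑ i, T i) = LinearMap.id)
    (hcp : ∀ i, ∃ (r : ℕ) (v : Fin r → Matrix ((j : Fin m) × Fin (nv j))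
        ((j : Fin m) × Fin (nv j)) ℂ),
      ∀ x, Matrix.blockDiagonal' (T i x) =
        ∑ k, (v k)ᴴ * Matrix.blockDiagonal' x * v k) :
    ∀ i (j : Fin m), ∃ μ : ℝ, 0 ≤ μ ∧ ∀ x, (T i x) j = (μ : ℂ) • x j := by
  choose r v hv using hcp
  have key : ∀ (j : Fin m) (p q : Fin (nv j)) (c d : (j : Fin m) × Fin (nv j)),
      ∑ s : (i : I) × Fin (r i), star (v s.1 s.2 ⟨j, p⟩ c) * v s.1 s.2 ⟨j, q⟩ d =
        Matrix.single (⟨j, p⟩ : (j : Fin m) × Fin (nv j)) ⟨j, q⟩ (1 : ℂ) c d := by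
    intro j p q c d
    have h1 : ∑ i, Matrix.blockDiagonal' (T i (Pi.single j (Matrix.single p q (1 : ℂ)))) =
        Matrix.single (⟨j, p⟩ : (j : Fin m) × Fin (nv j)) ⟨j, q⟩ (1 : ℂ) := by
      rw [← aux_block]
      conv_rhs => rw [← LinearMap.id_apply (R := ℂ)
        (Pi.single j (Matrix.single p q (1 : ℂ)) :
          (j : Fin m) → Matrix (Fin (nv j)) (Fin (nv j)) ℂ), ← hsum, LinearMap.sum_apply]
      exact (map_sum (Matrix.blockDiagonal'AddMonoidHom (fun j => Fin (nv j))
        (fun j => Fin (nv j)) ℂ) _ _).symm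
    rw [← h1, Fintype.sum_sigma, Matrix.sum_apply]
    refine Finset.sum_congr rfl fun i _ => ?_
    rw [hv, Matrix.sum_apply]
    refine Finset.sum_congr rfl fun k _ => ?_
    rw [aux_block, aux_entry]
  have hdiag : ∀ i k (a b : (j : Fin m) × Fin (nv j)), a ≠ b → v i k a b = 0 := by
    rintro i k ⟨j, p⟩ b hab
    refine aux_zero (fun s : (i : I) × Fin (r i) => v s.1 s.2 ⟨j, p⟩ b) ?_ ⟨i, k⟩
    rw [key j p p b b]
    simp [Matrix.single_apply, hab]
  have hconst : ∀ i k (j : Fin m) (p q : Fin (nv j)),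
      v i k ⟨j, p⟩ ⟨j, p⟩ = v i k ⟨j, q⟩ ⟨j, q⟩ := by
    intro i k j p q
    refine sub_eq_zero.1 (aux_zero (fun s : (i : I) × Fin (r i) =>
      v s.1 s.2 ⟨j, p⟩ ⟨j, p⟩ - v s.1 s.2 ⟨j, q⟩ ⟨j, q⟩) ?_ ⟨i, k⟩)
    simp only [star_sub, sub_mul, mul_sub, Finset.sum_sub_distrib, key]
    simp
  intro i j
  let z : Fin (nv j) := ⟨0, hnv j⟩
  refine ⟨∑ k, Complex.normSq (v i k ⟨j, z⟩ ⟨j, z⟩),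
    Finset.sum_nonneg fun k _ => Complex.normSq_nonneg _, fun x => ?_⟩
  ext p q
  have h := congrFun (congrFun (hv i x) ⟨j, p⟩) ⟨j, q⟩
  rw [Matrix.blockDiagonal'_apply_eq, Matrix.sum_apply] at h
  rw [h, Matrix.smul_apply, smul_eq_mul]
  push_cast
  rw [Finset.sum_mul]
  refine Finset.sum_congr rfl fun k _ => ?_
  rw [Matrix.mul_apply, Finset.sum_eq_single ⟨j, q⟩, Matrix.mul_apply,
    Finset.sum_eq_single ⟨j, p⟩, Matrix.conjTranspose_apply, Matrix.blockDiagonal'_apply_eq,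
    hconst i k j p z, hconst i k j q z, Complex.normSq_eq_conj_mul_self]
  · simp only [starRingEnd_apply]; ring
  · intro b _ hb
    rw [Matrix.conjTranspose_apply, hdiag i k _ _ hb]; simp
  · simp
  · intro b _ hb
    rw [hdiag i k _ _ hb]; simp
  · simp
end

section
/- Let N be a unital *-subalgebra of M_n(ℂ), E_N the trace-preserving conditional expectation onto N, and λ_1,…,λ_d ∈ M_n(ℂ) a Pimsner–Popa basis for M_n(ℂ) over N, i.e., x = Σ_{i=1}^d E_N(x λ_i*) λ_i for every x ∈ M_n(ℂ). Then the basis is orthonormal, i.e., E_N(λ_i λ_j*) = δ_{ij}·1 for all i,j, if and only if d·dim_ℂ N = n². -/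
open Matrix

/-- A Pimsner–Popa basis `λ₁,…,λ_d` for `Mₙ(ℂ)` over a unital *-subalgebra `N` is
orthonormal (`E_N(λᵢλⱼ*) = δᵢⱼ·1`) if and only if `d·dim_ℂ N = n²`. -/
theorem pimsner_popa_orthonormal_iff_dim (n : ℕ)
    (N : StarSubalgebra ℂ (Matrix (Fin n) (Fin n) ℂ))
    (E : Matrix (Fin n) (Fin n) ℂ →ₗ[ℂ] Matrix (Fin n) (Fin n) ℂ)
    (hEmem : ∀ x, E x ∈ N)
    (hEfix : ∀ y ∈ N, E y = y)
    (hEtr : ∀ x, ∀ y ∈ N, Matrix.trace (E x * y) = Matrix.trace (x * y))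
    (d : ℕ) (lam : Fin d → Matrix (Fin n) (Fin n) ℂ)
    (hbasis : ∀ x, x = ∑ i, E (x * (lam i)ᴴ) * lam i) :
    (∀ i j, E (lam i * (lam j)ᴴ) = if i = j then 1 else 0) ↔
      d * Module.finrank ℂ N = n ^ 2 := by
  classical
  have hfd : Module.Finite ℂ N :=
    Module.Finite.of_injective (N.toSubalgebra.val.toLinearMap : N →ₗ[ℂ] _) Subtype.val_injective
  have hmod : ∀ a ∈ N, ∀ x, E (a * x) = a * E x := by
    intro a ha x
    have hD : E (a * x) - a * E x ∈ N := sub_mem (hEmem _) (mul_mem ha (hEmem _))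
    have key : ∀ y ∈ N, Matrix.trace ((E (a * x) - a * E x) * y) = 0 := by
      intro y hy
      have h1 : Matrix.trace (a * E x * y) = Matrix.trace (a * x * y) := by
        rw [mul_assoc, Matrix.trace_mul_comm, mul_assoc, hEtr x (y * a) (mul_mem hy ha),
          ← mul_assoc, Matrix.trace_mul_comm, ← mul_assoc]
      rw [sub_mul, Matrix.trace_sub, hEtr _ y hy, h1, sub_self]
    have h2 := key _ (star_mem hD)
    rw [Matrix.star_eq_conjTranspose] at h2
    open scoped ComplexOrder in
    exact sub_eq_zero.mp (Matrix.trace_mul_conjTranspose_self_eq_zero_iff.mp h2)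
  let T : (Fin d → N) →ₗ[ℂ] Matrix (Fin n) (Fin n) ℂ :=
    { toFun := fun a => ∑ i, (a i : Matrix (Fin n) (Fin n) ℂ) * lam i
      map_add' := by
        intro a b
        simp [add_mul, Finset.sum_add_distrib]
      map_smul' := by
        intro c a
        simp [Finset.smul_sum] }
  have hT : ∀ a, T a = ∑ i, (a i : Matrix (Fin n) (Fin n) ℂ) * lam i := fun _ => rfl
  have hsurj : Function.Surjective T := by
    intro x
    refine ⟨fun i => ⟨E (x * (lam i)ᴴ), hEmem _⟩, ?_⟩
    rw [hT]
    exact (hbasis x).symm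
  have hd1 : Module.finrank ℂ (Fin d → N) = d * Module.finrank ℂ N := by
    simp [Module.finrank_pi_fintype]
  have hd2 : Module.finrank ℂ (Matrix (Fin n) (Fin n) ℂ) = n ^ 2 := by
    simp [Module.finrank_matrix, sq]
  constructor
  · intro h
    have hinj : Function.Injective T := by
      rw [← LinearMap.ker_eq_bot, LinearMap.ker_eq_bot']
      intro a ha
      funext j
      have h3 : E (T a * (lam j)ᴴ) = (a j : Matrix (Fin n) (Fin n) ℂ) := by
        rw [hT, Finset.sum_mul, map_sum]
        simp_rw [mul_assoc, hmod _ (a _).2, h]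
        simp
      rw [ha, zero_mul, map_zero] at h3
      exact Subtype.ext h3.symm
    rw [← hd1, ← hd2]
    exact (LinearEquiv.ofBijective T ⟨hinj, hsurj⟩).finrank_eq
  · intro h i j
    have hinj : Function.Injective T :=
      (LinearMap.injective_iff_surjective_of_finrank_eq_finrank (by rw [hd1, hd2, h])).mpr hsurj
    have h4 : (fun k => (⟨E (lam i * (lam k)ᴴ), hEmem _⟩ : N)) =
        fun k => if i = k then 1 else 0 := by
      apply hinj
      rw [hT, hT]
      refine (hbasis (lam i)).symm.trans ?_
      rw [Finset.sum_eq_single i]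
      · simp
      · intro b _ hb
        simp [hb.symm]
      · simp
    have h5 := congrArg (Subtype.val) (congrFun h4 j)
    simp only at h5
    rw [h5]
    split_ifs <;> rfl
end

section
/- Let N be a unital *-subalgebra of M_n(ℂ) and u ∈ M_n(ℂ) a unitary with u* N u = N. Then for every y ∈ N and all x_1, x_2 in the commutant N' of N: ⟨(x_1 x_2 u* y ⊗ 1_n)ψ_n, (u* y ⊗ 1_n)ψ_n⟩ = ⟨(x_2 x_1 u* y ⊗ 1_n)ψ_n, (u* y ⊗ 1_n)ψ_n⟩. That is, the vector state of any vector of the form (u*⊗1_n)ξ with ξ ∈ V_N, restricted to N'⊗1, is tracial. -/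
open Matrix
open scoped Kronecker

/-- The standard inner product `⟨v, w⟩ = ∑ᵢ vᵢ·conj(wᵢ)` on `ℂⁿ ⊗ ℂⁿ`. -/
noncomputable def inner2 (n : ℕ) (v w : Fin n × Fin n → ℂ) : ℂ :=
  ∑ p : Fin n × Fin n, v p * star (w p)

theorem kron_psi (n : ℕ) (A : Matrix (Fin n) (Fin n) ℂ) (i j : Fin n) :
    ((A ⊗ₖ (1 : Matrix (Fin n) (Fin n) ℂ)) *ᵥ psi n) (i, j) = A i j * (Real.sqrt n : ℂ)⁻¹ := by
  simp only [Matrix.mulVec, dotProduct, psi, Fintype.sum_prod_type, Matrix.kroneckerMap_apply,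
    Matrix.one_apply]
  simp

theorem inner2_kron (n : ℕ) (A B : Matrix (Fin n) (Fin n) ℂ) :
    inner2 n ((A ⊗ₖ (1 : Matrix (Fin n) (Fin n) ℂ)) *ᵥ psi n)
      ((B ⊗ₖ (1 : Matrix (Fin n) (Fin n) ℂ)) *ᵥ psi n)
      = (A * Bᴴ).trace * ((Real.sqrt n : ℂ)⁻¹ * star (Real.sqrt n : ℂ)⁻¹) := by
  simp only [inner2, Fintype.sum_prod_type, kron_psi, Matrix.trace, Matrix.diag, Matrix.mul_apply,
    Finset.sum_mul, Matrix.conjTranspose_apply, star_mul']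
  refine Finset.sum_congr rfl fun i _ => Finset.sum_congr rfl fun j _ => ?_
  ring

/-- If the unitary `u` normalises the unital *-subalgebra `N ⊆ Mₙ(ℂ)`, then for every
`y ∈ N` and all `x₁, x₂` in the commutant `N'`, the vector state of `(u* y ⊗ 1)ψₙ`
restricted to `N' ⊗ 1` is tracial:
`⟨(x₁x₂u*y ⊗ 1)ψₙ, (u*y ⊗ 1)ψₙ⟩ = ⟨(x₂x₁u*y ⊗ 1)ψₙ, (u*y ⊗ 1)ψₙ⟩`. -/
theorem vector_state_tracial_on_commutant (n : ℕ)
    (N : StarSubalgebra ℂ (Matrix (Fin n) (Fin n) ℂ))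
    (u : Matrix (Fin n) (Fin n) ℂ)
    (hu : uᴴ * u = 1) (hu' : u * uᴴ = 1)
    (huN : (fun y => uᴴ * y * u) '' (N : Set (Matrix (Fin n) (Fin n) ℂ))
        = (N : Set (Matrix (Fin n) (Fin n) ℂ)))
    (y : Matrix (Fin n) (Fin n) ℂ) (hy : y ∈ N)
    (x₁ x₂ : Matrix (Fin n) (Fin n) ℂ)
    (hx₁ : ∀ z ∈ N, x₁ * z = z * x₁)
    (hx₂ : ∀ z ∈ N, x₂ * z = z * x₂) :
    inner2 n (((x₁ * x₂ * uᴴ * y) ⊗ₖ (1 : Matrix (Fin n) (Fin n) ℂ)) *ᵥ psi n)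
        (((uᴴ * y) ⊗ₖ (1 : Matrix (Fin n) (Fin n) ℂ)) *ᵥ psi n)
      = inner2 n (((x₂ * x₁ * uᴴ * y) ⊗ₖ (1 : Matrix (Fin n) (Fin n) ℂ)) *ᵥ psi n)
        (((uᴴ * y) ⊗ₖ (1 : Matrix (Fin n) (Fin n) ℂ)) *ᵥ psi n) := by
  rw [inner2_kron, inner2_kron]
  congr 1
  have hz : uᴴ * (y * yᴴ) * u ∈ N := by
    have h : uᴴ * (y * yᴴ) * u ∈ (N : Set (Matrix (Fin n) (Fin n) ℂ)) := by
      rw [← huN]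
      exact ⟨y * yᴴ, mul_mem hy (star_mem (s := N) hy), rfl⟩
    exact h
  have e : ∀ a b : Matrix (Fin n) (Fin n) ℂ,
      a * b * uᴴ * y * (uᴴ * y)ᴴ = a * b * (uᴴ * (y * yᴴ) * u) := by
    intro a b
    simp only [Matrix.conjTranspose_mul, Matrix.conjTranspose_conjTranspose, Matrix.mul_assoc]
  rw [e, e, Matrix.mul_assoc x₁, hx₂ _ hz, ← Matrix.mul_assoc, Matrix.trace_mul_comm,
    ← Matrix.mul_assoc]
end

section
/- Let m ≥ 1, let n_j, l_j ≥ 1 for j = 1,…,m, and let d ≥ 1. Let K := ⨿_{j=1}^m ({j} × {1,…,n_j} × {1,…,l_j} × {1,…,d}) and inside the matrix algebra Mat_K(ℂ) define: M := the *-subalgebra of block-diagonal matrices whose j-th diagonal block has the form 1_{n_j} ⊗ Y_j with Y_j ∈ M_{l_j}(ℂ)⊗M_d(ℂ) arbitrary; and N ⊆ M := the subalgebra of elements whose j-th block is 1_{n_j} ⊗ 1_{l_j} ⊗ x for a single x ∈ M_d(ℂ) independent of j (so N ≅ M_d(ℂ) is a factor and [M:N] = Σ_j l_j²). Let N' and M'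 denote the commutants of N and M in Mat_K(ℂ), and S := {X ∈ N' : Tr(Z* X) = 0 for all Z ∈ M'}. Then there exist k ≥ 1 and self-adjoint idempotents P_1,…,P_c ∈ Mat_{K×{1,…,k}}(ℂ) with c = Σ_{j=1}^m l_j², such that Σ_a P_a = 1, each P_a commutes with Z ⊗ 1_k for every Z ∈ M' (so that P_a ∈ M ⊗ M_k(ℂ)), and P_a·(X ⊗ 1_k)·P_a = 0 for every X ∈ S and every a. (This exhibits a quantum [M:N]-colouring of the quantum graph (N', M, B(H)), proving χ_q(N',M,B(H)) ≤ [M:N].) -/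
open Matrix
open scoped Kronecker

/-- Index set for `H = ⊕ⱼ ℂ^{nⱼ} ⊗ ℂ^{lⱼ} ⊗ ℂ^d`. -/
abbrev Kq (m : ℕ) (nv lv : Fin m → ℕ) (d : ℕ) : Type :=
  (j : Fin m) × (Fin (nv j) × Fin (lv j) × Fin d)

/-- `M = ⊕ⱼ 1_{nⱼ} ⊗ M_{lⱼ}(ℂ) ⊗ M_d(ℂ)` inside `Mat_K(ℂ)`. -/
def Mset (m : ℕ) (nv lv : Fin m → ℕ) (d : ℕ) :
    Set (Matrix (Kq m nv lv d) (Kq m nv lv d) ℂ) :=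
  {X | ∃ Y : (j : Fin m) → Matrix (Fin (lv j) × Fin d) (Fin (lv j) × Fin d) ℂ,
    X = Matrix.blockDiagonal' (fun j => (1 : Matrix (Fin (nv j)) (Fin (nv j)) ℂ) ⊗ₖ Y j)}

/-- `N ≅ M_d(ℂ)`, embedded in `M` as `⊕ⱼ 1_{nⱼ} ⊗ 1_{lⱼ} ⊗ x`. -/
def Nset (m : ℕ) (nv lv : Fin m → ℕ) (d : ℕ) :
    Set (Matrix (Kq m nv lv d) (Kq m nv lv d) ℂ) :=
  {X | ∃ x : Matrix (Fin d) (Fin d) ℂ,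
    X = Matrix.blockDiagonal' (fun j => (1 : Matrix (Fin (nv j)) (Fin (nv j)) ℂ) ⊗ₖ
      ((1 : Matrix (Fin (lv j)) (Fin (lv j)) ℂ) ⊗ₖ x))}

/-- The commutant of a set of matrices. -/
def commutant {K : Type} [Fintype K] (A : Set (Matrix K K ℂ)) : Set (Matrix K K ℂ) :=
  {x | ∀ y ∈ A, x * y = y * x}

/-- The operator system `S = N' ∩ (M')^⊥` of the quantum graph `(N', M, B(H))`. -/
def Sgraph (m : ℕ) (nv lv : Fin m → ℕ) (d : ℕ) :
    Set (Matrix (Kq m nv lv d) (Kq m nv lv d) ℂ) :=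
  {X | X ∈ commutant (Nset m nv lv d) ∧
    ∀ Z ∈ commutant (Mset m nv lv d), Matrix.trace (Zᴴ * X) = 0}

lemma bell_aux (l : ℕ) [NeZero l] {W R : Type} [Fintype W] [DecidableEq W] [Fintype R]
    [DecidableEq R] (e : W ≃ ZMod l × R) :
    ∃ B : ZMod l × ZMod l → Matrix (Fin l × W) (Fin l × W) ℂ,
      (∀ a, (B a)ᴴ = B a ∧ B a * B a = B a) ∧ (∑ a, B a) = 1 ∧
      (∀ a, ∀ E : Matrix (Fin l) (Fin l) ℂ, E.trace = 0 →
        B a * (E ⊗ₖ (1 : Matrix W W ℂ)) * B a = 0) := by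
  classical
  have hl : (l : ℂ) ≠ 0 := by exact_mod_cast NeZero.ne l
  let f : Fin l ≃ ZMod l := (ZMod.finEquiv l).toEquiv
  let χ : AddChar (ZMod l) ℂ := ZMod.stdAddChar
  let V : ZMod l × ZMod l → Matrix (Fin l × W) R ℂ := fun a =>
    Matrix.of fun s r => if s.2 = e.symm (f s.1 + a.2, r) then χ (a.1 * f s.1) else 0
  have hconj : ∀ z, star (χ z) = χ (-z) := fun z => by
    rw [AddChar.map_neg_eq_conj]; rfl
  have hVV : ∀ a, ∀ E : Matrix (Fin l) (Fin l) ℂ,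
      (V a)ᴴ * (E ⊗ₖ (1 : Matrix W W ℂ)) * V a = E.trace • (1 : Matrix R R ℂ) := by
    intro a E
    ext r r'
    simp only [Matrix.mul_apply, Fintype.sum_prod_type, Matrix.conjTranspose_apply, V,
      Matrix.of_apply, Matrix.kroneckerMap_apply, Matrix.one_apply, Matrix.smul_apply,
      apply_ite star, star_zero, hconj]
    simp only [mul_ite, ite_mul, zero_mul, mul_zero, mul_one, Finset.sum_ite_eq,
      Finset.sum_ite_eq', Finset.mem_univ, if_true, e.symm.injective.eq_iff, Prod.mk.injEq,
      add_left_inj, f.injective.eq_iff, smul_eq_mul]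
    by_cases h : r = r'
    · subst h
      simp only [and_true, Finset.sum_ite_eq', Finset.sum_ite_eq, Finset.mem_univ, if_true,
        Matrix.trace, Matrix.diag]
      refine Finset.sum_congr rfl fun x _ => ?_
      rw [mul_right_comm, ← AddChar.map_add_eq_mul]
      simp
    · have h' : ¬ r' = r := fun h' => h h'.symm
      simp [h, h']
  have hV1 : ∀ a, (V a)ᴴ * V a = (l : ℂ) • (1 : Matrix R R ℂ) := by
    intro a
    have := hVV a 1
    simpa using this
  refine ⟨fun a => (l : ℂ)⁻¹ • (V a * (V a)ᴴ), ?_, ?_, ?_⟩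
  · intro a
    constructor
    · simp [Matrix.conjTranspose_smul, Matrix.conjTranspose_mul]
    · have : V a * (V a)ᴴ * (V a * (V a)ᴴ) = (l : ℂ) • (V a * (V a)ᴴ) := by
        rw [Matrix.mul_assoc, ← Matrix.mul_assoc ((V a)ᴴ), hV1]
        simp
      simp only [Matrix.smul_mul, Matrix.mul_smul, this, smul_smul]
      congr 1
      field_simp
  · have hchar : ∀ z : ZMod l, ∑ p, χ (p * z) = if z = 0 then (l : ℂ) else 0 := by
      intro z
      have := AddChar.sum_mulShift z (ZMod.isPrimitive_stdAddChar l)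
      simpa [ZMod.card] using this
    ext ⟨x, w⟩ ⟨x', w'⟩
    simp only [Matrix.sum_apply, Matrix.smul_apply, Matrix.mul_apply, V, Matrix.of_apply,
      Matrix.conjTranspose_apply, apply_ite star, star_zero, hconj, smul_eq_mul,
      Fintype.sum_prod_type]
    rw [Finset.sum_comm]
    have key : ∀ q : ZMod l, ∑ p : ZMod l, (l : ℂ)⁻¹ * ∑ r : R,
        (if w = e.symm (f x + q, r) then χ (p * f x) else 0) *
          (if w' = e.symm (f x' + q, r) then χ (-(p * f x')) else 0)
        = if x = x' ∧ w = w' ∧ q = (e w).1 - f x then 1 else 0 := by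
      intro q
      have h1 : ∀ p : ZMod l, ∑ r : R,
        (if w = e.symm (f x + q, r) then χ (p * f x) else 0) *
          (if w' = e.symm (f x' + q, r) then χ (-(p * f x')) else 0)
          = if (e w).1 = f x + q ∧ w' = e.symm (f x' + q, (e w).2) then
              χ (p * (f x - f x')) else 0 := by
        intro p
        rw [Finset.sum_eq_single (e w).2]
        · have : (w = e.symm (f x + q, (e w).2)) ↔ (e w).1 = f x + q := by
            rw [Equiv.eq_symm_apply, Prod.ext_iff]; simp
          simp only [this, ite_and]
          have hχ : χ (p * (f x - f x')) = χ (p * f x) * χ (-(p * f x')) := by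
            rw [← AddChar.map_add_eq_mul]; congr 1; ring
          split_ifs <;> simp [hχ]
        · intro r _ hr
          rw [if_neg, zero_mul]
          rintro rfl
          simp at hr
        · simp
      simp only [h1]
      rw [← Finset.mul_sum]
      by_cases hc : (e w).1 = f x + q ∧ w' = e.symm (f x' + q, (e w).2)
      · simp only [hc, and_self, if_true, hchar, sub_eq_zero, f.injective.eq_iff]
        by_cases hx : x = x'
        · subst hx
          have hw : w = w' := by
            rw [hc.2, Equiv.eq_symm_apply, Prod.ext_iff]; exact ⟨hc.1, rfl⟩
          simp [hl, ← hw, ← hc.2]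
        · simp [hx]
      · simp only [hc, if_false, Finset.sum_const_zero, mul_zero]
        rw [if_neg]
        rintro ⟨rfl, rfl, rfl⟩
        apply hc
        simp
    simp only [key, Matrix.one_apply, Prod.mk.injEq]
    by_cases hx : x = x' <;> by_cases hw : w = w' <;> simp [hx, hw]
  · intro a E hE
    have := hVV a E
    rw [hE, zero_smul] at this
    simp only [Matrix.smul_mul, Matrix.mul_smul]
    have h2 : V a * (V a)ᴴ * (E ⊗ₖ (1 : Matrix W W ℂ)) * (V a * (V a)ᴴ)
        = V a * ((V a)ᴴ * (E ⊗ₖ (1 : Matrix W W ℂ)) * V a) * (V a)ᴴ := by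
      simp only [Matrix.mul_assoc]
    rw [h2, this]
    simp

lemma colour_aux (m : ℕ) (lv : Fin m → ℕ) (hlv : ∀ j, 1 ≤ lv j) :
    ∃ (k : ℕ), 1 ≤ k ∧ ∃ D : (j : Fin m) → Fin (∑ j, (lv j) ^ 2) →
        Matrix (Fin (lv j) × Fin k) (Fin (lv j) × Fin k) ℂ,
      (∀ j a, (D j a)ᴴ = D j a ∧ D j a * D j a = D j a) ∧ (∀ j, (∑ a, D j a) = 1) ∧
      (∀ j a, ∀ E : Matrix (Fin (lv j)) (Fin (lv j)) ℂ, E.trace = 0 →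
        D j a * (E ⊗ₖ (1 : Matrix (Fin k) (Fin k) ℂ)) * D j a = 0) ∧
      (∀ i j a, i ≠ j → D i a = 0 ∨ D j a = 0) := by
  classical
  haveI : ∀ j, NeZero (lv j) := fun j => ⟨by have := hlv j; omega⟩
  let W := (j : Fin m) → ZMod (lv j)
  let k := Fintype.card W
  let eW : Fin k ≃ W := (Fintype.equivFin W).symm
  have hB := fun j => bell_aux (lv j) (eW.trans (Equiv.piSplitAt j (fun j => ZMod (lv j))))
  choose B hB1 hB2 hB3 using hB
  have hcard : Fintype.card ((j : Fin m) × (ZMod (lv j) × ZMod (lv j))) = ∑ j, (lv j) ^ 2 := by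
    simp [Fintype.card_sigma, ZMod.card, sq]
  let τ : Fin (∑ j, (lv j) ^ 2) ≃ (j : Fin m) × (ZMod (lv j) × ZMod (lv j)) :=
    (Fintype.equivFinOfCardEq hcard).symm
  let D' : (j : Fin m) → ((j : Fin m) × (ZMod (lv j) × ZMod (lv j))) →
      Matrix (Fin (lv j) × Fin k) (Fin (lv j) × Fin k) ℂ := fun j t =>
    if h : t.1 = j then B j (h ▸ t.2) else 0
  have hself : ∀ j p, D' j ⟨j, p⟩ = B j p := fun j p => by simp [D']
  have hne : ∀ i j p, i ≠ j → D' j ⟨i, p⟩ = 0 := fun i j p h => by simp [D', h]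
  refine ⟨k, Fintype.card_pos, fun j a => D' j (τ a), ?_, ?_, ?_, ?_⟩
  · intro j a
    beta_reduce
    generalize τ a = t
    obtain ⟨i, p⟩ := t
    by_cases h : i = j
    · subst h; simp only [hself]; exact hB1 i p
    · simp [hne i j p h]
  · intro j
    rw [Equiv.sum_comp τ (D' j), Fintype.sum_sigma, Finset.sum_eq_single j]
    · simp only [hself]; exact hB2 j
    · intro i _ hi
      simp [hne i j _ hi]
    · simp
  · intro j a E hE
    beta_reduce
    generalize τ a = t
    obtain ⟨i, p⟩ := t
    by_cases h : i = j
    · subst h; simp only [hself]; exact hB3 i p E hE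
    · simp [hne i j p h]
  · intro i j a hij
    beta_reduce
    generalize τ a = t
    obtain ⟨i', p⟩ := t
    by_cases h : i' = j
    · subst h; left; exact hne _ _ _ (Ne.symm hij)
    · right; exact hne _ _ _ h

lemma Sgraph_trace (m : ℕ) (nv lv : Fin m → ℕ) (d : ℕ)
    (X : Matrix (Kq m nv lv d) (Kq m nv lv d) ℂ) (hX : X ∈ Sgraph m nv lv d)
    (j : Fin m) (n n' : Fin (nv j)) (e e' : Fin d) :
    ∑ x : Fin (lv j), X ⟨j, n, x, e⟩ ⟨j, n', x, e'⟩ = 0 := by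
  classical
  obtain ⟨hN, hM⟩ := hX
  have hd : (d : ℂ) ≠ 0 := by
    have := e.pos
    exact_mod_cast this.ne'
  have h1 : ∀ (x : Fin (lv j)) (b : Fin d), X ⟨j, n, x, e⟩ ⟨j, n', x, e'⟩ =
      if e = e' then X ⟨j, n, x, b⟩ ⟨j, n', x, b⟩ else 0 := by
    intro x b
    have h := congrFun (congrFun (hN _ ⟨Matrix.single e' b 1, rfl⟩) ⟨j, n, x, e⟩) ⟨j, n', x, b⟩
    simp only [Matrix.mul_apply, Fintype.sum_sigma] at h
    rw [Finset.sum_eq_single j, Finset.sum_eq_single j] at h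
    · simpa [Matrix.blockDiagonal'_apply_eq, Fintype.sum_prod_type, Matrix.one_apply,
        Matrix.single_apply, ite_and, Finset.sum_ite_eq, eq_comm] using h
    · intro i _ hi
      simp [Matrix.blockDiagonal'_apply_ne _ _ _ (Ne.symm hi)]
    · simp
    · intro i _ hi
      simp [Matrix.blockDiagonal'_apply_ne _ _ _ hi]
    · simp
  have h2 : ∑ x : Fin (lv j), ∑ b : Fin d, X ⟨j, n, x, b⟩ ⟨j, n', x, b⟩ = 0 := by
    let Z : Matrix (Kq m nv lv d) (Kq m nv lv d) ℂ := Matrix.blockDiagonal' (fun i =>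
      (Matrix.of fun s t => if (⟨i, s⟩ : (i : Fin m) × Fin (nv i)) = ⟨j, n⟩ ∧
        (⟨i, t⟩ : (i : Fin m) × Fin (nv i)) = ⟨j, n'⟩ then (1 : ℂ) else 0) ⊗ₖ
        (1 : Matrix (Fin (lv i) × Fin d) (Fin (lv i) × Fin d) ℂ))
    have hZ : Z ∈ commutant (Mset m nv lv d) := by
      rintro _ ⟨Y, rfl⟩
      simp only [Z]
      rw [← Matrix.blockDiagonal'_mul, ← Matrix.blockDiagonal'_mul]
      congr 1
      funext i
      rw [← Matrix.mul_kronecker_mul, ← Matrix.mul_kronecker_mul]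
      simp
    have h := hM Z hZ
    simp only [Matrix.trace, Matrix.diag, Matrix.mul_apply, Matrix.conjTranspose_apply,
      Fintype.sum_sigma] at h
    rw [Finset.sum_eq_single j] at h
    · have h' : ∀ y : Fin (nv j) × Fin (lv j) × Fin d,
          ∑ i, ∑ z : Fin (nv i) × Fin (lv i) × Fin d, star (Z ⟨i, z⟩ ⟨j, y⟩) * X ⟨i, z⟩ ⟨j, y⟩
          = ∑ z : Fin (nv j) × Fin (lv j) × Fin d, star (Z ⟨j, z⟩ ⟨j, y⟩) * X ⟨j, z⟩ ⟨j, y⟩ := by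
        intro y
        rw [Finset.sum_eq_single j]
        · intro i _ hi
          simp [Z, Matrix.blockDiagonal'_apply_ne _ _ _ hi]
        · simp
      simp only [h'] at h
      simpa [Z, Matrix.blockDiagonal'_apply_eq, Fintype.sum_prod_type, Matrix.one_apply,
        ite_and, apply_ite] using h
    · intro i _ hi
      refine Finset.sum_eq_zero fun y _ => Finset.sum_eq_zero fun i' _ =>
        Finset.sum_eq_zero fun z _ => ?_
      by_cases hii : i' = i
      · subst hii
        simp [Z, Matrix.blockDiagonal'_apply_eq, hi]
      · simp [Z, Matrix.blockDiagonal'_apply_ne _ _ _ hii]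
    · simp
  by_cases hee : e = e'
  · rw [Finset.sum_comm] at h2
    have h3 : ∀ b : Fin d, ∑ x : Fin (lv j), X ⟨j, n, x, b⟩ ⟨j, n', x, b⟩ =
        ∑ x : Fin (lv j), X ⟨j, n, x, e⟩ ⟨j, n', x, e'⟩ := fun b =>
      Finset.sum_congr rfl fun x _ => by rw [h1 x b, if_pos hee]
    simp only [h3, Finset.sum_const, Finset.card_univ, Fintype.card_fin, nsmul_eq_mul] at h2
    exact (mul_eq_zero.mp h2).resolve_left hd
  · refine Finset.sum_eq_zero fun x _ => ?_
    rw [h1 x e, if_neg hee]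

/-- Rearrangement of the tensor factors. -/
def shuffleEquiv (m : ℕ) (nv lv : Fin m → ℕ) (d k : ℕ) :
    Kq m nv lv d × Fin k ≃
      (j : Fin m) × ((Fin (lv j) × Fin k) × (Fin (nv j) × Fin d)) where
  toFun s := ⟨s.1.1, (s.1.2.2.1, s.2), (s.1.2.1, s.1.2.2.2)⟩
  invFun t := (⟨t.1, t.2.2.1, t.2.1.1, t.2.2.2⟩, t.2.1.2)
  left_inv _ := rfl
  right_inv _ := rfl

/-- Upper bound `χ_q(N', M, B(H)) ≤ [M:N]`: there is a quantum `∑ⱼ lⱼ²`-colouring of the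
quantum graph `(N', M, B(H))` arising from the factor inclusion `N ≅ M_d(ℂ) ⊆ M`. -/
theorem quantum_colouring_exists (m : ℕ) (hm : 1 ≤ m)
    (nv lv : Fin m → ℕ) (hnv : ∀ j, 1 ≤ nv j) (hlv : ∀ j, 1 ≤ lv j)
    (d : ℕ) (hd : 1 ≤ d) :
    ∃ (k : ℕ), 1 ≤ k ∧
      ∃ P : Fin (∑ j, (lv j) ^ 2) →
          Matrix (Kq m nv lv d × Fin k) (Kq m nv lv d × Fin k) ℂ,
        (∀ a, (P a)ᴴ = P a ∧ P a * P a = P a) ∧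
        (∑ a, P a) = 1 ∧
        (∀ a, ∀ Z ∈ commutant (Mset m nv lv d),
          P a * (Z ⊗ₖ (1 : Matrix (Fin k) (Fin k) ℂ))
            = (Z ⊗ₖ (1 : Matrix (Fin k) (Fin k) ℂ)) * P a) ∧
        (∀ a, ∀ X ∈ Sgraph m nv lv d,
          P a * (X ⊗ₖ (1 : Matrix (Fin k) (Fin k) ℂ)) * P a = 0) := by
  classical
  obtain ⟨k, hk, D, hD1, hD2, hD3, hD4⟩ := colour_aux m lv hlv
  let F := shuffleEquiv m nv lv d k
  let A : Fin (∑ j, (lv j) ^ 2) → (j : Fin m) →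
      Matrix ((Fin (lv j) × Fin k) × (Fin (nv j) × Fin d))
        ((Fin (lv j) × Fin k) × (Fin (nv j) × Fin d)) ℂ := fun a j => D j a ⊗ₖ 1
  let Q := fun a => Matrix.blockDiagonal' (A a)
  refine ⟨k, hk, fun a => (Q a).submatrix F F, ?_, ?_, ?_, ?_⟩
  · intro a
    constructor
    · rw [Matrix.conjTranspose_submatrix]
      congr 1
      simp only [Q, Matrix.blockDiagonal'_conjTranspose]
      congr 1
      funext j
      simp [A, Matrix.conjTranspose_kronecker, (hD1 j a).1]
    · rw [Matrix.submatrix_mul_equiv]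
      congr 1
      simp only [Q]
      rw [← Matrix.blockDiagonal'_mul]
      congr 1
      funext j
      simp only [A]
      rw [← Matrix.mul_kronecker_mul, (hD1 j a).2, Matrix.one_mul]
  · have hQ : ∑ a, Q a = 1 := by
      ext ⟨i, s, u⟩ ⟨j, t, v⟩
      rw [Matrix.sum_apply]
      by_cases hij : i = j
      · subst hij
        have := congrFun (congrFun (hD2 i) s) t
        rw [Matrix.sum_apply] at this
        simp only [Q, Matrix.blockDiagonal'_apply_eq, A, Matrix.kroneckerMap_apply]
        rw [← Finset.sum_mul, this]
        by_cases h1 : s = t <;> by_cases h2 : u = v <;> simp [Matrix.one_apply, h1, h2]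
      · simp [Q, Matrix.blockDiagonal'_apply_ne _ _ _ hij, Matrix.one_apply, hij]
    ext s t
    have := congrFun (congrFun hQ (F s)) (F t)
    rw [Matrix.sum_apply] at this ⊢
    simpa [Matrix.one_apply] using this
  · intro a Z hZ
    have hsl : ∀ w w' : Fin k, Matrix.of (fun s t : Kq m nv lv d =>
        (Q a).submatrix F F (s, w) (t, w')) ∈ Mset m nv lv d := by
      intro w w'
      refine ⟨fun j => (Matrix.of fun x x' => D j a (x, w) (x', w')) ⊗ₖ 1, ?_⟩
      ext ⟨i, n, x, e⟩ ⟨j, n', x', e'⟩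
      by_cases hij : i = j
      · subst hij
        by_cases h1 : n = n' <;> by_cases h2 : e = e' <;>
          simp [Q, F, shuffleEquiv, A, Matrix.blockDiagonal'_apply_eq, Matrix.one_apply, h1, h2]
      · simp [Q, F, shuffleEquiv, Matrix.blockDiagonal'_apply_ne _ _ _ hij]
    ext ⟨s, w⟩ ⟨t, w'⟩
    have h := congrFun (congrFun (hZ _ (hsl w w')) s) t
    simp only [Matrix.mul_apply, Matrix.of_apply] at h
    rw [Matrix.mul_apply, Matrix.mul_apply, Fintype.sum_prod_type, Fintype.sum_prod_type]
    simp only [Matrix.kroneckerMap_apply, Matrix.one_apply, mul_ite, ite_mul, mul_one, mul_zero,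
      zero_mul, Finset.sum_ite_eq, Finset.sum_ite_eq', Finset.mem_univ, if_true]
    exact h.symm
  · intro a X hX
    let Y := (X ⊗ₖ (1 : Matrix (Fin k) (Fin k) ℂ)).submatrix F.symm F.symm
    have hY : X ⊗ₖ (1 : Matrix (Fin k) (Fin k) ℂ) = Y.submatrix F F := by
      simp [Y, Matrix.submatrix_submatrix]
    rw [hY, Matrix.submatrix_mul_equiv, Matrix.submatrix_mul_equiv]
    have hz : Q a * Y * Q a = 0 := by
      ext ⟨i, s, u⟩ ⟨j, t, v⟩
      have hexp : (Q a * Y * Q a) ⟨i, s, u⟩ ⟨j, t, v⟩ =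
          (D i a * (Matrix.of fun s' t' => Y ⟨i, s', u⟩ ⟨j, t', v⟩) * D j a) s t := by
        have e1 : ∀ y, (Q a * Y) ⟨i, s, u⟩ y = ∑ s', D i a s s' * Y ⟨i, s', u⟩ y := by
          intro y
          rw [Matrix.mul_apply, Fintype.sum_sigma, Finset.sum_eq_single i]
          · rw [Fintype.sum_prod_type]
            simp [Q, A, Matrix.blockDiagonal'_apply_eq, Matrix.one_apply]
          · intro i' _ hi
            simp [Q, Matrix.blockDiagonal'_apply_ne _ _ _ (Ne.symm hi)]
          · simp
        rw [Matrix.mul_apply, Fintype.sum_sigma, Finset.sum_eq_single j]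
        · rw [Fintype.sum_prod_type, Matrix.mul_apply]
          refine Finset.sum_congr rfl fun t' _ => ?_
          rw [Finset.sum_eq_single v]
          · rw [e1, Matrix.mul_apply]
            simp [Q, A, Matrix.blockDiagonal'_apply_eq]
          · intro v' _ hv
            simp [Q, A, Matrix.blockDiagonal'_apply_eq, Matrix.one_apply, hv]
          · simp
        · intro i' _ hi
          simp [Q, Matrix.blockDiagonal'_apply_ne _ _ _ hi]
        · simp
      rw [hexp]
      by_cases hij : i = j
      · subst hij
        have hE : (Matrix.of fun s' t' => Y ⟨i, s', u⟩ ⟨i, t', v⟩) =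
            (Matrix.of fun x x' : Fin (lv i) => X ⟨i, u.1, x, u.2⟩ ⟨i, v.1, x', v.2⟩) ⊗ₖ
              (1 : Matrix (Fin k) (Fin k) ℂ) := by
          ext ⟨x, w⟩ ⟨x', w'⟩
          simp [Y, F, shuffleEquiv]
        rw [hE, hD3 i a (Matrix.of fun x x' : Fin (lv i) =>
          X ⟨i, u.1, x, u.2⟩ ⟨i, v.1, x', v.2⟩) (Sgraph_trace m nv lv d X hX i u.1 v.1 u.2 v.2)]
        rfl
      · rcases hD4 i j a hij with h | h <;> simp [h]
    rw [hz]
    rfl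
end

section
/- Let m ≥ 1, let n_j, l_j ≥ 1 for j = 1,…,m, and let d ≥ 1. Let K := ⨿_{j=1}^m ({j} × {1,…,n_j} × {1,…,l_j} × {1,…,d}) and inside Mat_K(ℂ) define: M := the *-subalgebra of block-diagonal matrices whose j-th diagonal block has the form 1_{n_j} ⊗ Y_j with Y_j ∈ M_{l_j}(ℂ)⊗M_d(ℂ) arbitrary; and N ⊆ M := the subalgebra of elements whose j-th block is 1_{n_j} ⊗ 1_{l_j} ⊗ x for a single x ∈ M_d(ℂ) independent of j. Let N' and M' denote the commutants of N and M in Mat_K(ℂ), and S := {X ∈ N' : Tr(Z* X) = 0 for all Z ∈ M'}. Then for every k ≥ 1, every c ≥ 1, and every family of self-adjoint idempotents P_1,…,P_c ∈ Mat_{K×{1,…,k}}(ℂ) with Σ_a P_a = 1, each P_a commuting with Z ⊗ 1_k for all Z ∈ M', and P_a·(X ⊗ 1_k)·P_a = 0 for all X ∈ S and all a, one has c ≥ Σ_{j=1}^m l_j². (Hence the quantum chromatic number of the quantum graph (N', M, B(H)) equals the index [M:N] = Σ_j l_j².) -/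
open Matrix
open scoped Kronecker

namespace QCol

variable {m : ℕ} {nv lv : Fin m → ℕ} {d : ℕ}

/-- The element of `M` determined by a family of blocks. -/
noncomputable def Aof (Y : (j : Fin m) → Matrix (Fin (lv j) × Fin d) (Fin (lv j) × Fin d) ℂ) :
    Matrix (Kq m nv lv d) (Kq m nv lv d) ℂ :=
  Matrix.blockDiagonal' (fun j => (1 : Matrix (Fin (nv j)) (Fin (nv j)) ℂ) ⊗ₖ Y j)

/-- Basis index in the row `s = 0`. -/
def rr (hnv : ∀ j, 1 ≤ nv j) (u : (j : Fin m) × Fin (lv j)) (x : Fin d) : Kq m nv lv d :=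
  ⟨u.1, (⟨0, hnv u.1⟩, u.2, x)⟩

/-- The isometry `ℂ^d → H` onto the copy labelled by `u`. -/
def ww (hnv : ∀ j, 1 ≤ nv j) (u : (j : Fin m) × Fin (lv j)) :
    Matrix (Kq m nv lv d) (Fin d) ℂ :=
  Matrix.of fun p x => if p = rr hnv u x then 1 else 0

lemma ww_orth (hnv : ∀ j, 1 ≤ nv j) (u v : (j : Fin m) × Fin (lv j)) :
    (ww (lv := lv) (d := d) hnv u)ᴴ * ww (lv := lv) (d := d) hnv v = if u = v then 1 else 0 := by
  ext x y
  have : (rr hnv u x = rr hnv v y) ↔ (u = v ∧ x = y) := by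
    constructor
    · intro h
      obtain ⟨j, t⟩ := u
      obtain ⟨j', t'⟩ := v
      simp only [rr, Sigma.mk.injEq] at h
      obtain ⟨rfl, h⟩ := h
      simpa using h
    · rintro ⟨rfl, rfl⟩; rfl
  simp only [Matrix.mul_apply, Matrix.conjTranspose_apply, ww, Matrix.of_apply]
  simp only [apply_ite star, star_one, star_zero, mul_ite, mul_one, mul_zero]
  rw [Finset.sum_ite_eq' Finset.univ (rr hnv v y)]
  simp only [Finset.mem_univ, if_true, eq_comm (a := rr hnv v y), this]
  by_cases h : u = v <;> simp [h, Matrix.one_apply]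

/-- The `(t, t')` block of a matrix. -/
def bk {l d : ℕ} (A : Matrix (Fin l × Fin d) (Fin l × Fin d) ℂ) (t t' : Fin l) :
    Matrix (Fin d) (Fin d) ℂ := Matrix.of fun x y => A (t, x) (t', y)

lemma Aof_mul_ww (hnv : ∀ j, 1 ≤ nv j)
    (Y : (j : Fin m) → Matrix (Fin (lv j) × Fin d) (Fin (lv j) × Fin d) ℂ)
    (j : Fin m) (t : Fin (lv j)) :
    Aof (nv := nv) Y * ww (lv := lv) (d := d) hnv ⟨j, t⟩ =
      ∑ t', ww (lv := lv) (d := d) hnv ⟨j, t'⟩ * bk (Y j) t' t := by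
  ext ⟨j', s, t', x'⟩ x
  rw [Matrix.sum_apply]
  simp only [Matrix.mul_apply, ww, bk, Matrix.of_apply, mul_ite, mul_one, mul_zero, ite_mul,
    one_mul, zero_mul]
  rw [Finset.sum_ite_eq' Finset.univ (rr hnv ⟨j, t⟩ x)]
  simp only [Finset.mem_univ, if_true, rr, Aof]
  by_cases h : j' = j
  · subst h
    rw [Matrix.blockDiagonal'_apply_eq]
    simp only [Matrix.kroneckerMap_apply, Matrix.one_apply, Sigma.mk.injEq, heq_eq_eq, true_and,
      Prod.mk.injEq]
    by_cases hs : s = ⟨0, hnv j'⟩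
    · simp [hs, ite_and]
    · simp [hs]
  · rw [Matrix.blockDiagonal'_apply_ne _ _ _ h]
    simp [h]

lemma Aof_conjTranspose
    (Y : (j : Fin m) → Matrix (Fin (lv j) × Fin d) (Fin (lv j) × Fin d) ℂ) :
    (Aof (nv := nv) Y)ᴴ = Aof (fun j => (Y j)ᴴ) := by
  simp [Aof, Matrix.blockDiagonal'_conjTranspose, Matrix.conjTranspose_kronecker]

lemma ww_mul_Aof (hnv : ∀ j, 1 ≤ nv j)
    (Y : (j : Fin m) → Matrix (Fin (lv j) × Fin d) (Fin (lv j) × Fin d) ℂ)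
    (j : Fin m) (t : Fin (lv j)) :
    (ww (lv := lv) (d := d) hnv ⟨j, t⟩)ᴴ * Aof (nv := nv) Y =
      ∑ t', bk (Y j) t t' * (ww (lv := lv) (d := d) hnv ⟨j, t'⟩)ᴴ := by
  have h := congrArg (fun A => Aᴴ) (Aof_mul_ww hnv (fun j => (Y j)ᴴ) j t)
  rw [Matrix.conjTranspose_mul, Aof_conjTranspose, Matrix.conjTranspose_sum] at h
  simp only [Matrix.conjTranspose_conjTranspose, Matrix.conjTranspose_mul] at h
  rw [h]
  refine Finset.sum_congr rfl fun t' _ => ?_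
  congr 1
  ext x y
  simp [bk, Matrix.conjTranspose_apply]

lemma Aof_mem (Y : (j : Fin m) → Matrix (Fin (lv j) × Fin d) (Fin (lv j) × Fin d) ℂ) :
    Aof (nv := nv) Y ∈ Mset m nv lv d := ⟨Y, rfl⟩

/-- Matrix unit-like operators. -/
noncomputable def XX (hnv : ∀ j, 1 ≤ nv j) (u v : (j : Fin m) × Fin (lv j)) :
    Matrix (Kq m nv lv d) (Kq m nv lv d) ℂ := ww (lv := lv) (d := d) hnv u * (ww (lv := lv) (d := d) hnv v)ᴴ

lemma XX_mem_N (hnv : ∀ j, 1 ≤ nv j) (u v : (j : Fin m) × Fin (lv j)) :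
    XX (lv := lv) (d := d) hnv u v ∈ commutant (Nset m nv lv d) := by
  rintro _ ⟨x, rfl⟩
  obtain ⟨Y, hY⟩ : ∃ Y : (j : Fin m) → Matrix (Fin (lv j) × Fin d) (Fin (lv j) × Fin d) ℂ,
      Y = fun j => (1 : Matrix (Fin (lv j)) (Fin (lv j)) ℂ) ⊗ₖ x := ⟨_, rfl⟩
  have e : ∀ (j) (t t' : Fin (lv j)), bk (Y j) t t' = if t = t' then x else 0 := by
    intro j t t'
    subst hY
    ext a b
    by_cases h : t = t' <;> simp [bk, h]
  suffices h : XX (lv := lv) (d := d) hnv u v * Aof (nv := nv) Y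
      = Aof (nv := nv) Y * XX (lv := lv) (d := d) hnv u v by
    subst hY
    exact h
  obtain ⟨j, t⟩ := u
  obtain ⟨j', t'⟩ := v
  rw [XX, Matrix.mul_assoc, ww_mul_Aof, ← Matrix.mul_assoc, Aof_mul_ww]
  simp only [e]
  rw [Finset.sum_eq_single t', Finset.sum_eq_single t, if_pos rfl, if_pos rfl,
    Matrix.mul_assoc]
  · intro b _ hb
    rw [if_neg hb, Matrix.mul_zero]
  · simp
  · intro b _ hb
    rw [if_neg hb.symm, Matrix.zero_mul]
  · simp

/-- Matrix units in `M`. -/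
noncomputable def GG (u v : (j : Fin m) × Fin (lv j)) :
    Matrix (Kq m nv lv d) (Kq m nv lv d) ℂ :=
  Aof fun j => Matrix.of fun p q =>
    if (⟨j, p.1⟩ : (j : Fin m) × Fin (lv j)) = u ∧
      (⟨j, q.1⟩ : (j : Fin m) × Fin (lv j)) = v ∧ p.2 = q.2 then 1 else 0

lemma GG_mul_ww (hnv : ∀ j, 1 ≤ nv j) (j : Fin m) (t t' : Fin (lv j))
    (w : (j : Fin m) × Fin (lv j)) :
    GG (nv := nv) (lv := lv) (d := d) ⟨j, t⟩ ⟨j, t'⟩ * ww (lv := lv) (d := d) hnv w = if w = ⟨j, t'⟩ then ww (lv := lv) (d := d) hnv ⟨j, t⟩ else 0 := by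
  obtain ⟨i, r⟩ := w
  rw [GG, Aof_mul_ww]
  by_cases h : (⟨i, r⟩ : (j : Fin m) × Fin (lv j)) = ⟨j, t'⟩
  · obtain ⟨rfl, h⟩ := Sigma.mk.inj_iff.1 h
    obtain rfl := eq_of_heq h
    rw [Finset.sum_eq_single t]
    · rw [if_pos rfl]
      refine Eq.trans (congrArg _ ?_) (Matrix.mul_one _)
      ext x y
      simp [bk, Matrix.one_apply]
    · intro b _ hb
      refine Eq.trans (congrArg _ ?_) (Matrix.mul_zero _)
      ext x y
      simp [bk, hb]
    · simp
  · rw [if_neg h]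
    refine Finset.sum_eq_zero fun b _ => ?_
    refine Eq.trans (congrArg _ ?_) (Matrix.mul_zero _)
    ext x y
    simp only [bk, Matrix.of_apply, h, false_and, and_false, if_false, Matrix.zero_apply]

lemma GG_conjTranspose (u v : (j : Fin m) × Fin (lv j)) :
    (GG (nv := nv) (lv := lv) (d := d) u v)ᴴ = GG (nv := nv) (lv := lv) (d := d) v u := by
  rw [GG, Aof_conjTranspose, GG]
  congr 1
  ext j p q
  simp only [Matrix.conjTranspose_apply, Matrix.of_apply, apply_ite star, star_one, star_zero]
  refine if_congr ?_ rfl rfl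
  tauto

lemma ww_mul_GG (hnv : ∀ j, 1 ≤ nv j) (j : Fin m) (t t' : Fin (lv j))
    (w : (j : Fin m) × Fin (lv j)) :
    (ww (lv := lv) (d := d) hnv w)ᴴ * GG (nv := nv) (lv := lv) (d := d) ⟨j, t⟩ ⟨j, t'⟩ = if w = ⟨j, t⟩ then (ww (lv := lv) (d := d) hnv ⟨j, t'⟩)ᴴ else 0 := by
  have h := congrArg (fun A => Aᴴ) (GG_mul_ww (d := d) hnv j t' t w)
  rw [Matrix.conjTranspose_mul, GG_conjTranspose] at h
  rw [h]
  split_ifs <;> simp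

lemma trace_comm_zero (u v : (j : Fin m) × Fin (lv j))
    (Y Z : Matrix (Kq m nv lv d) (Kq m nv lv d) ℂ) (hZ : Z ∈ commutant (Mset m nv lv d)) :
    Matrix.trace (Zᴴ * (GG (nv := nv) (lv := lv) (d := d) u v * Y - Y * GG (nv := nv) (lv := lv) (d := d) u v)) = 0 := by
  have h := congrArg Matrix.conjTranspose (hZ (GG (nv := nv) (lv := lv) (d := d) v u) (Aof_mem _))
  rw [Matrix.conjTranspose_mul, Matrix.conjTranspose_mul, GG_conjTranspose] at h
  rw [Matrix.mul_sub, Matrix.trace_sub, ← Matrix.mul_assoc, ← Matrix.mul_assoc, ← h,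
    Matrix.trace_mul_comm (Zᴴ * Y), ← Matrix.mul_assoc, sub_self]

lemma XX_mem_S (hnv : ∀ j, 1 ≤ nv j) (u v : (j : Fin m) × Fin (lv j)) (h : u ≠ v) :
    XX (lv := lv) (d := d) hnv u v ∈ Sgraph m nv lv d := by
  refine ⟨XX_mem_N hnv u v, fun Z hZ => ?_⟩
  have := trace_comm_zero u u (XX (lv := lv) (d := d) hnv u v) Z hZ
  obtain ⟨j, t⟩ := u
  rw [XX, ← Matrix.mul_assoc, GG_mul_ww, Matrix.mul_assoc (ww (lv := lv) (d := d) hnv _), ww_mul_GG] at this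
  simpa [h.symm, XX] using this

lemma XX_sub_mem_S (hnv : ∀ j, 1 ≤ nv j) (j : Fin m) (t t' : Fin (lv j)) :
    XX (lv := lv) (d := d) hnv ⟨j, t⟩ ⟨j, t⟩ - XX (lv := lv) (d := d) hnv ⟨j, t'⟩ ⟨j, t'⟩ ∈ Sgraph m nv lv d := by
  refine ⟨fun y hy => ?_, fun Z hZ => ?_⟩
  · rw [Matrix.sub_mul, Matrix.mul_sub, XX_mem_N hnv _ _ y hy, XX_mem_N hnv _ _ y hy]
  · have := trace_comm_zero ⟨j, t⟩ ⟨j, t'⟩ (XX (lv := lv) (d := d) hnv ⟨j, t'⟩ ⟨j, t⟩) Z hZ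
    rw [XX, ← Matrix.mul_assoc, GG_mul_ww, Matrix.mul_assoc (ww (lv := lv) (d := d) hnv _), ww_mul_GG] at this
    simpa [XX] using this

lemma sum_XX_mem (hnv : ∀ j, 1 ≤ nv j) (j : Fin m) :
    ∑ t, XX (lv := lv) (d := d) hnv ⟨j, t⟩ ⟨j, t⟩ ∈ commutant (Mset m nv lv d) := by
  rintro _ ⟨Y, rfl⟩
  change _ * Aof (nv := nv) Y = Aof (nv := nv) Y * _
  rw [Finset.sum_mul, Finset.mul_sum]
  simp only [XX]
  simp only [← Matrix.mul_assoc (Aof (nv := nv) Y), Aof_mul_ww]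
  simp only [Matrix.mul_assoc, ww_mul_Aof, Matrix.mul_sum, Matrix.sum_mul]
  rw [Finset.sum_comm]

lemma entry_le_one {n : Type*} [Fintype n] (Q : Matrix n n ℂ) (hQ : Qᴴ = Q)
    (hQQ : Q * Q = Q) (i : n) : (Q i i).re ≤ 1 := by
  have h1 : (Q i i).re = ∑ x, Complex.normSq (Q i x) := by
    conv_lhs => rw [← hQQ, Matrix.mul_apply, Complex.re_sum]
    refine Finset.sum_congr rfl fun x _ => ?_
    have : Q x i = star (Q i x) := by
      conv_lhs => rw [← hQ, Matrix.conjTranspose_apply]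
    rw [this]
    simp [Complex.normSq_apply]
  have h2 : Complex.normSq (Q i i) ≤ ∑ x, Complex.normSq (Q i x) :=
    Finset.single_le_sum (f := fun x => Complex.normSq (Q i x))
      (fun x _ => Complex.normSq_nonneg _) (Finset.mem_univ i)
  rw [← h1, Complex.normSq_apply] at h2
  nlinarith [mul_self_nonneg (Q i i).im, mul_self_nonneg ((Q i i).re - 1)]

/-- Amplification of `ww`. -/
noncomputable def WW (hnv : ∀ j, 1 ≤ nv j) (k : ℕ) (u : (j : Fin m) × Fin (lv j)) :
    Matrix (Kq m nv lv d × Fin k) (Fin d × Fin k) ℂ :=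
  ww (lv := lv) (d := d) hnv u ⊗ₖ (1 : Matrix (Fin k) (Fin k) ℂ)

lemma WW_mul (hnv : ∀ j, 1 ≤ nv j) (k : ℕ) (u v : (j : Fin m) × Fin (lv j)) :
    WW (lv := lv) (d := d) hnv k u * (WW (lv := lv) (d := d) hnv k v)ᴴ = XX (lv := lv) (d := d) hnv u v ⊗ₖ (1 : Matrix (Fin k) (Fin k) ℂ) := by
  rw [WW, WW, Matrix.conjTranspose_kronecker, ← Matrix.mul_kronecker_mul, XX]
  simp

lemma WW_orth (hnv : ∀ j, 1 ≤ nv j) (k : ℕ) (u v : (j : Fin m) × Fin (lv j)) :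
    (WW (lv := lv) (d := d) hnv k u)ᴴ * (WW (lv := lv) (d := d) hnv k v) = if u = v then 1 else 0 := by
  rw [WW, WW, Matrix.conjTranspose_kronecker, ← Matrix.mul_kronecker_mul, ww_orth]
  split_ifs <;> simp

/-- The compressed projection. -/
noncomputable def QQ (hnv : ∀ j, 1 ≤ nv j) (k : ℕ)
    (P : Matrix (Kq m nv lv d × Fin k) (Kq m nv lv d × Fin k) ℂ) :
    Matrix (Fin d × Fin k) (Fin d × Fin k) ℂ :=
  ∑ u : (j : Fin m) × Fin (lv j), (lv u.1 : ℂ) • ((WW (lv := lv) (d := d) hnv k u)ᴴ * P * WW (lv := lv) (d := d) hnv k u)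

lemma QQ_herm (hnv : ∀ j, 1 ≤ nv j) (k : ℕ)
    (P : Matrix (Kq m nv lv d × Fin k) (Kq m nv lv d × Fin k) ℂ) (hP : Pᴴ = P) :
    (QQ (d := d) hnv k P)ᴴ = QQ (d := d) hnv k P := by
  simp [QQ, Matrix.conjTranspose_sum, Matrix.conjTranspose_smul, Matrix.conjTranspose_mul, hP,
    Matrix.mul_assoc]

lemma QQ_one (hnv : ∀ j, 1 ≤ nv j) (k : ℕ) :
    QQ (lv := lv) (d := d) hnv k 1 = ((∑ j, (lv j) ^ 2 : ℕ) : ℂ) • 1 := by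
  simp only [QQ, Matrix.mul_one, WW_orth, if_true]
  rw [← Finset.sum_smul, Fintype.sum_sigma]
  simp [sq]

lemma QQ_idem (hnv : ∀ j, 1 ≤ nv j) (k : ℕ)
    (P : Matrix (Kq m nv lv d × Fin k) (Kq m nv lv d × Fin k) ℂ)
    (hPP : P * P = P)
    (hcomm : ∀ Z ∈ commutant (Mset m nv lv d),
      P * (Z ⊗ₖ (1 : Matrix (Fin k) (Fin k) ℂ)) = (Z ⊗ₖ (1 : Matrix (Fin k) (Fin k) ℂ)) * P)
    (hcol : ∀ X ∈ Sgraph m nv lv d,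
      P * (X ⊗ₖ (1 : Matrix (Fin k) (Fin k) ℂ)) * P = 0) :
    QQ (d := d) hnv k P * QQ (d := d) hnv k P = QQ (d := d) hnv k P := by
  have key : ∀ u v : (j : Fin m) × Fin (lv j),
      ((WW (lv := lv) (d := d) hnv k u)ᴴ * P * WW (lv := lv) (d := d) hnv k u) * ((WW (lv := lv) (d := d) hnv k v)ᴴ * P * WW (lv := lv) (d := d) hnv k v)
        = (WW (lv := lv) (d := d) hnv k u)ᴴ * (P * (XX (lv := lv) (d := d) hnv u v ⊗ₖ (1 : Matrix (Fin k) (Fin k) ℂ)) * P)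
          * WW (lv := lv) (d := d) hnv k v := by
    intro u v
    rw [← WW_mul]
    simp only [Matrix.mul_assoc]
  have diag : ∀ u : (j : Fin m) × Fin (lv j),
      (lv u.1 : ℂ) • (((WW (lv := lv) (d := d) hnv k u)ᴴ * P * WW (lv := lv) (d := d) hnv k u) * ((WW (lv := lv) (d := d) hnv k u)ᴴ * P * WW (lv := lv) (d := d) hnv k u))
        = (WW (lv := lv) (d := d) hnv k u)ᴴ * P * WW (lv := lv) (d := d) hnv k u := by
    rintro ⟨j, t⟩
    have h1 : ∀ t' : Fin (lv j),
        P * (XX (lv := lv) (d := d) hnv ⟨j, t'⟩ ⟨j, t'⟩ ⊗ₖ (1 : Matrix (Fin k) (Fin k) ℂ)) * P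
          = P * (XX (lv := lv) (d := d) hnv ⟨j, t⟩ ⟨j, t⟩ ⊗ₖ (1 : Matrix (Fin k) (Fin k) ℂ)) * P := by
      intro t'
      have := hcol _ (XX_sub_mem_S hnv j t' t)
      rw [sub_eq_add_neg, Matrix.add_kronecker, Matrix.mul_add, Matrix.add_mul,
        ← neg_one_smul ℂ, Matrix.smul_kronecker, Matrix.mul_smul, Matrix.smul_mul,
        neg_one_smul, ← sub_eq_add_neg, sub_eq_zero] at this
      exact this
    have hk : (∑ t', XX (lv := lv) (d := d) hnv ⟨j, t'⟩ ⟨j, t'⟩) ⊗ₖ (1 : Matrix (Fin k) (Fin k) ℂ)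
        = ∑ t', XX (lv := lv) (d := d) hnv ⟨j, t'⟩ ⟨j, t'⟩ ⊗ₖ (1 : Matrix (Fin k) (Fin k) ℂ) := by
      ext a b
      simp [Matrix.sum_apply, Finset.sum_mul]
    have h2 : (lv j : ℂ) • (P * (XX (lv := lv) (d := d) hnv ⟨j, t⟩ ⟨j, t⟩ ⊗ₖ (1 : Matrix (Fin k) (Fin k) ℂ)) * P)
        = (∑ t', XX (lv := lv) (d := d) hnv ⟨j, t'⟩ ⟨j, t'⟩ ⊗ₖ (1 : Matrix (Fin k) (Fin k) ℂ)) * P := by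
      have h3 := hcomm _ (sum_XX_mem hnv j)
      rw [hk] at h3
      have h4 := congrArg (· * P) h3
      simp only [Matrix.mul_assoc _ P P, hPP] at h4
      rw [← h4, Matrix.mul_sum, Matrix.sum_mul, Finset.sum_congr rfl fun t' _ => h1 t']
      simp [Nat.cast_smul_eq_nsmul]
    rw [key, ← Matrix.smul_mul, ← Matrix.mul_smul, h2, ← Matrix.mul_assoc, Matrix.mul_sum]
    congr 2
    rw [Finset.sum_eq_single t]
    · rw [← WW_mul, ← Matrix.mul_assoc, WW_orth]
      simp
    · intro b _ hb
      rw [← WW_mul, ← Matrix.mul_assoc, WW_orth, if_neg, Matrix.zero_mul]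
      simpa using hb.symm
    · simp
  conv_lhs => rw [QQ, Finset.sum_mul]
  rw [QQ]
  refine Finset.sum_congr rfl fun u _ => ?_
  rw [Finset.mul_sum, Finset.sum_eq_single u]
  · rw [Matrix.smul_mul, Matrix.mul_smul, diag]
  · intro v _ hv
    rw [Matrix.smul_mul, Matrix.mul_smul, key, hcol _ (XX_mem_S hnv u v hv.symm)]
    simp
  · simp

end QCol

/-- Lower bound `χ_qc(N', M, B(H)) ≥ [M:N]`: any quantum (commuting) `c`-colouring of the
quantum graph `(N', M, B(H))` arising from the factor inclusion `N ≅ M_d(ℂ) ⊆ M`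
satisfies `c ≥ ∑ⱼ lⱼ²`. -/
theorem quantum_colouring_lower_bound (m : ℕ) (hm : 1 ≤ m)
    (nv lv : Fin m → ℕ) (hnv : ∀ j, 1 ≤ nv j) (hlv : ∀ j, 1 ≤ lv j)
    (d : ℕ) (hd : 1 ≤ d)
    (k : ℕ) (hk : 1 ≤ k) (c : ℕ) (hc : 1 ≤ c)
    (P : Fin c → Matrix (Kq m nv lv d × Fin k) (Kq m nv lv d × Fin k) ℂ)
    (hPproj : ∀ a, (P a)ᴴ = P a ∧ P a * P a = P a)
    (hPsum : (∑ a, P a) = 1)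
    (hPcomm : ∀ a, ∀ Z ∈ commutant (Mset m nv lv d),
      P a * (Z ⊗ₖ (1 : Matrix (Fin k) (Fin k) ℂ))
        = (Z ⊗ₖ (1 : Matrix (Fin k) (Fin k) ℂ)) * P a)
    (hPcol : ∀ a, ∀ X ∈ Sgraph m nv lv d,
      P a * (X ⊗ₖ (1 : Matrix (Fin k) (Fin k) ℂ)) * P a = 0) :
    (∑ j, (lv j) ^ 2) ≤ c := by
  have hsum : ∑ a, QCol.QQ (lv := lv) (d := d) hnv k (P a) = QCol.QQ (lv := lv) (d := d) hnv k 1 := by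
    rw [← hPsum]
    simp only [QCol.QQ]
    rw [Finset.sum_comm]
    simp only [Matrix.mul_sum, Matrix.sum_mul, Finset.smul_sum]
  rw [QCol.QQ_one] at hsum
  have i : Fin d × Fin k := (⟨0, hd⟩, ⟨0, hk⟩)
  have h := congrArg (fun A => (A i i).re) hsum
  simp only [Matrix.sum_apply, Complex.re_sum, Matrix.smul_apply, Matrix.one_apply_eq,
    smul_eq_mul, mul_one, Complex.natCast_re] at h
  have hle : ∑ a, (QCol.QQ (lv := lv) (d := d) hnv k (P a) i i).re ≤ ∑ _a : Fin c, (1 : ℝ) :=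
    Finset.sum_le_sum fun a _ => QCol.entry_le_one _
      (QCol.QQ_herm hnv k _ (hPproj a).1)
      (QCol.QQ_idem hnv k _ (hPproj a).2 (hPcomm a) (hPcol a)) i
  rw [h] at hle
  simp only [Finset.sum_const, Finset.card_univ, Fintype.card_fin, nsmul_eq_mul, mul_one] at hle
  exact_mod_cast hle
end

section
/- Let L be a unital complex *-algebra and let d, m, n ≥ 1. Let P_1,…,P_c be matrices indexed by {1,…,d}×{1,…,m}×{1,…,n} with entries in L such that: each P_a is a self-adjoint idempotent (P_a* = P_a = P_a²); Σ_{a=1}^c P_a = 1; each P_a commutes with (A ⊗ 1_m ⊗ 1_n)·1_L for every A ∈ M_d(ℂ); and P_a·((X_0 ⊗ 1_n)·1_L)·P_a = 0 for every X_0 ∈ M_d(ℂ)⊗M_m(ℂ) with (id_d ⊗ Tr)(X_0) = 0. Define R_a ∈ M_n(L) by (R_a)_{k,l} := (m/d)·Σ_{j=1}^d Σ_{i=1}^m (P_a)_{(j,i,k),(j,i,l)}. Then each R_a is a self-adjoint idempotent in M_n(L), and Σ_{a=1}^c R_a = m²·1. -/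
open Matrix
open scoped Kronecker

/-- Reassociation `(M_d ⊗ M_m) ⊗ M_n ≃ M_d ⊗ (M_m ⊗ M_n)` for complex matrices. -/
def assocK (d m n : ℕ)
    (Z : Matrix ((Fin d × Fin m) × Fin n) ((Fin d × Fin m) × Fin n) ℂ) :
    Matrix (Fin d × Fin m × Fin n) (Fin d × Fin m × Fin n) ℂ :=
  Matrix.reindex (Equiv.prodAssoc (Fin d) (Fin m) (Fin n))
    (Equiv.prodAssoc (Fin d) (Fin m) (Fin n)) Z

theorem aux_comm {L : Type} [Ring L] [Algebra ℂ L] {d m n : ℕ}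
    (P : Matrix (Fin d × Fin m × Fin n) (Fin d × Fin m × Fin n) L)
    (h : ∀ A : Matrix (Fin d) (Fin d) ℂ,
      P * ((A ⊗ₖ (1 : Matrix (Fin m × Fin n) (Fin m × Fin n) ℂ)).map (algebraMap ℂ L))
        = ((A ⊗ₖ (1 : Matrix (Fin m × Fin n) (Fin m × Fin n) ℂ)).map (algebraMap ℂ L))
          * P) (p q u v : Fin d) (x y : Fin m × Fin n) :
    (if q = v then P (u, x) (p, y) else 0) = (if p = u then P (q, x) (v, y) else 0) := by
  have h1 := congrFun (congrFun (h (Matrix.single p q 1)) (u, x)) (v, y)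
  have e1 : (P * (((Matrix.single p q (1:ℂ)) ⊗ₖ
      (1 : Matrix (Fin m × Fin n) (Fin m × Fin n) ℂ)).map (algebraMap ℂ L))) (u, x) (v, y)
      = (if q = v then P (u, x) (p, y) else 0) := by
    rw [Matrix.mul_apply, Finset.sum_eq_single (p, y)]
    · by_cases hq : q = v <;> simp [Matrix.single_apply, hq]
    · rintro ⟨w, z⟩ - hne
      by_cases hw : p = w
      · have : z ≠ y := fun hz => hne (by rw [hw, hz])
        simp [Matrix.one_apply, this]
      · simp [Matrix.single_apply, hw]
    · simp
  have e2 : ((((Matrix.single p q (1:ℂ)) ⊗ₖ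
      (1 : Matrix (Fin m × Fin n) (Fin m × Fin n) ℂ)).map (algebraMap ℂ L)) * P) (u, x) (v, y)
      = (if p = u then P (q, x) (v, y) else 0) := by
    rw [Matrix.mul_apply, Finset.sum_eq_single (q, x)]
    · by_cases hq : p = u <;> simp [Matrix.single_apply, hq]
    · rintro ⟨w, z⟩ - hne
      by_cases hw : q = w
      · have : x ≠ z := fun hz => hne (by rw [hw, hz])
        simp [Matrix.one_apply, this]
      · simp [Matrix.single_apply, hw]
    · simp
  rw [← e1, ← e2, h1]

theorem aux_entry_s13 {L : Type} [Ring L] [Algebra ℂ L] {d m n : ℕ}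
    (P : Matrix (Fin d × Fin m × Fin n) (Fin d × Fin m × Fin n) L)
    (j : Fin d) (Y : Matrix (Fin m) (Fin m) ℂ) (x y : Fin d × Fin m × Fin n) :
    (P * ((assocK d m n ((Matrix.single j j (1:ℂ) ⊗ₖ Y) ⊗ₖ
      (1 : Matrix (Fin n) (Fin n) ℂ))).map (algebraMap ℂ L)) * P) x y
    = ∑ i, ∑ i', Y i i' • ∑ p, P x (j, i, p) * P (j, i', p) y := by
  have e : ∀ z i' p, (P * ((assocK d m n ((Matrix.single j j (1:ℂ) ⊗ₖ Y) ⊗ₖ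
      (1 : Matrix (Fin n) (Fin n) ℂ))).map (algebraMap ℂ L))) x (z, i', p)
      = if j = z then ∑ i, Y i i' • P x (j, i, p) else 0 := by
    intro z i' p
    rw [Matrix.mul_apply, Fintype.sum_prod_type, Finset.sum_eq_single j]
    · rw [Fintype.sum_prod_type]
      by_cases hz : j = z
      · simp only [hz, if_true]
        refine Finset.sum_congr rfl fun i _ => ?_
        rw [Finset.sum_eq_single p]
        · simp [assocK, Algebra.smul_def, Algebra.commutes]
        · intro b _ hb
          simp [assocK, Matrix.one_apply, hb]
        · simp
      · simp [assocK, Matrix.single_apply, hz]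
    · intro b _ hb
      simp [assocK, Matrix.single_apply, hb.symm]
    · simp
  rw [Matrix.mul_apply, Fintype.sum_prod_type, Finset.sum_eq_single j]
  · rw [Fintype.sum_prod_type, Finset.sum_comm' (t' := Finset.univ) (s' := fun _ => Finset.univ) (by simp)]
    simp only [e, if_true, Finset.sum_mul, Finset.smul_sum, smul_mul_assoc]
    rw [Finset.sum_comm]
    rw [Finset.sum_comm (f := fun i i' => ∑ p, Y i i' • (P x (j, i, p) * P (j, i', p) y))]
    refine Finset.sum_congr rfl fun i' _ => ?_
    rw [Finset.sum_comm]
  · intro b _ hb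
    simp [e, hb.symm]
  · simp

theorem aux_star {L : Type} [Ring L] [StarRing L] [Algebra ℂ L] (m d : ℕ) (hd : 1 ≤ d) (x : L) :
    star (((m : ℂ) / (d : ℂ)) • x) = ((m : ℂ) / (d : ℂ)) • star x := by
  have hd' : (d : ℂ) ≠ 0 := by exact_mod_cast (by omega : d ≠ 0)
  have key : ∀ y : L, (d : ℂ) • (((m : ℂ) / (d : ℂ)) • y) = (m : ℂ) • y := by
    intro y
    rw [smul_smul, mul_div_cancel₀ _ hd']
  have h1 : (d : ℂ) • star (((m : ℂ) / (d : ℂ)) • x) = (m : ℂ) • star x := by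
    have := congrArg star (key x)
    rw [Nat.cast_smul_eq_nsmul, Nat.cast_smul_eq_nsmul, star_nsmul, star_nsmul] at this
    rw [Nat.cast_smul_eq_nsmul, Nat.cast_smul_eq_nsmul, this]
  rw [← key (star x)] at h1
  have h2 := congrArg (fun y => (d : ℂ)⁻¹ • y) h1
  simpa [smul_smul, inv_mul_cancel₀ hd', inv_mul_cancel_left₀ hd'] using h2

/-- If `(L, c, {P_a})` is a colouring of the quantum graph `(N', M, B(H))` with
`N ⊆ M` factors (matrix form), then `R_a = [M:N]·(E_N ⊗ id_L)(P_a)` are self-adjoint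
idempotents in `Mₙ(L)` with `∑_a R_a = m²·1`. -/
theorem colouring_gives_projections (L : Type) [Ring L] [StarRing L] [Algebra ℂ L]
    (d m n : ℕ) (hd : 1 ≤ d) (hm : 1 ≤ m) (hn : 1 ≤ n) (c : ℕ)
    (P : Fin c → Matrix (Fin d × Fin m × Fin n) (Fin d × Fin m × Fin n) L)
    (hPsa : ∀ a, (P a)ᴴ = P a) (hPidem : ∀ a, P a * P a = P a)
    (hPsum : (∑ a, P a) = 1)
    (hPcomm : ∀ a, ∀ A : Matrix (Fin d) (Fin d) ℂ,
      P a * ((A ⊗ₖ (1 : Matrix (Fin m × Fin n) (Fin m × Fin n) ℂ)).map (algebraMap ℂ L))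
        = ((A ⊗ₖ (1 : Matrix (Fin m × Fin n) (Fin m × Fin n) ℂ)).map (algebraMap ℂ L))
          * P a)
    (hPcol : ∀ a, ∀ X₀ : Matrix (Fin d × Fin m) (Fin d × Fin m) ℂ,
      (∀ i j : Fin d, (∑ s : Fin m, X₀ (i, s) (j, s)) = 0) →
      P a * ((assocK d m n (X₀ ⊗ₖ (1 : Matrix (Fin n) (Fin n) ℂ))).map (algebraMap ℂ L))
          * P a = 0)
    (R : Fin c → Matrix (Fin n) (Fin n) L)
    (hR : ∀ a k l, R a k l
      = ((m : ℂ) / (d : ℂ)) • ∑ j : Fin d, ∑ i : Fin m, P a ((j, i, k)) ((j, i, l))) :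
    (∀ a, (R a)ᴴ = R a ∧ R a * R a = R a) ∧
    (∑ a, R a) = ((m : ℂ) ^ 2) • (1 : Matrix (Fin n) (Fin n) L) := by
  have hd' : (d : ℂ) ≠ 0 := by exact_mod_cast (by omega : d ≠ 0)
  have hm' : (m : ℂ) ≠ 0 := by exact_mod_cast (by omega : m ≠ 0)
  refine ⟨fun a => ⟨?_, ?_⟩, ?_⟩
  · ext k l
    rw [Matrix.conjTranspose_apply, hR, hR, aux_star m d hd, star_sum]
    congr 1
    refine Finset.sum_congr rfl fun j _ => ?_
    rw [star_sum]
    refine Finset.sum_congr rfl fun i _ => ?_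
    rw [← Matrix.conjTranspose_apply, hPsa]
  · have j0 : Fin d := ⟨0, hd⟩
    have hc := aux_comm (P a) (hPcomm a)
    have hR' : ∀ k l, R a k l = (m : ℂ) • ∑ i, P a (j0, i, k) (j0, i, l) := by
      intro k l
      have : ∀ j ∈ (Finset.univ : Finset (Fin d)), ∑ i : Fin m, P a ((j, i, k)) ((j, i, l))
          = ∑ i, P a (j0, i, k) (j0, i, l) := by
        intro j _
        refine Finset.sum_congr rfl fun i _ => ?_
        simpa using hc j j0 j j0 (i, k) (i, l)
      rw [hR, Finset.sum_congr rfl this, Finset.sum_const, Finset.card_univ, Fintype.card_fin,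
        ← Nat.cast_smul_eq_nsmul ℂ, smul_smul, div_mul_cancel₀ _ hd']
    have hoff : ∀ v x y, v ≠ j0 → P a (j0, x) (v, y) = 0 := by
      intro v x y hv
      have := hc j0 j0 j0 v x y
      simpa [hv.symm] using this.symm
    have hid : ∀ x y, ∑ i, ∑ p, P a (j0, x) (j0, i, p) * P a (j0, i, p) (j0, y)
        = P a (j0, x) (j0, y) := by
      intro x y
      have h1 := congrFun (congrFun (hPidem a) (j0, x)) (j0, y)
      rw [Matrix.mul_apply, Fintype.sum_prod_type, Finset.sum_eq_single j0,
        Fintype.sum_prod_type] at h1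
      · exact h1
      · intro b _ hb
        simp [hoff b _ _ hb]
      · simp
    have hY : ∀ (Y : Matrix (Fin m) (Fin m) ℂ), Y.trace = 0 → ∀ x y,
        ∑ i, ∑ i', Y i i' • ∑ p, P a (j0, x) (j0, i, p) * P a (j0, i', p) (j0, y) = 0 := by
      intro Y hYt x y
      rw [← aux_entry_s13, hPcol a]
      · rfl
      · intro i j
        simp only [Matrix.kroneckerMap_apply, ← Finset.mul_sum]
        have : ∑ s, Y s s = 0 := hYt
        rw [this, mul_zero]
    have hne : ∀ i j x y, i ≠ j →
        ∑ p, P a (j0, x) (j0, i, p) * P a (j0, j, p) (j0, y) = 0 := by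
      intro i j x y hij
      have := hY (Matrix.single i j 1) (by simp [hij]) x y
      rw [Finset.sum_eq_single i, Finset.sum_eq_single j] at this
      · simpa using this
      · intro b _ hb
        simp [Matrix.single_apply, hb.symm]
      · simp
      · intro b _ hb
        simp [Matrix.single_apply, hb.symm]
      · simp
    have heq : ∀ i j x y, 
        ∑ p, P a (j0, x) (j0, i, p) * P a (j0, i, p) (j0, y)
        = ∑ p, P a (j0, x) (j0, j, p) * P a (j0, j, p) (j0, y) := by
      intro i j x y
      have := hY (Matrix.diagonal (fun s => (if s = i then 1 else 0) - (if s = j then 1 else 0)))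
        (by simp) x y
      have h2 : ∀ s ∈ (Finset.univ : Finset (Fin m)), ∑ i', (Matrix.diagonal (fun s =>
          (if s = i then (1:ℂ) else 0) - (if s = j then 1 else 0))) s i' •
          ∑ p, P a (j0, x) (j0, s, p) * P a (j0, i', p) (j0, y)
          = (if s = i then ∑ p, P a (j0, x) (j0, s, p) * P a (j0, s, p) (j0, y) else 0)
            - (if s = j then ∑ p, P a (j0, x) (j0, s, p) * P a (j0, s, p) (j0, y) else 0) := by
        intro s _
        rw [Finset.sum_eq_single s]
        · rw [Matrix.diagonal_apply_eq, sub_smul, ite_smul, ite_smul, one_smul, zero_smul]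
        · intro b _ hb
          simp [Matrix.diagonal_apply_ne _ hb.symm]
        · simp
      rw [Finset.sum_congr rfl h2, Finset.sum_sub_distrib] at this
      simpa [sub_eq_zero] using this
    have hdiag : ∀ i x y, (m : ℂ) • ∑ p, P a (j0, x) (j0, i, p) * P a (j0, i, p) (j0, y)
        = P a (j0, x) (j0, y) := by
      intro i x y
      rw [← hid x y, Finset.sum_congr rfl (fun j _ => heq j i x y), Finset.sum_const,
        Finset.card_univ, Fintype.card_fin, ← Nat.cast_smul_eq_nsmul ℂ]
    ext k l
    rw [Matrix.mul_apply]
    simp only [hR', smul_mul_assoc, mul_smul_comm, ← Finset.smul_sum]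
    congr 1
    simp only [Finset.sum_mul, Finset.mul_sum]
    rw [Finset.sum_comm, Finset.smul_sum]
    refine Finset.sum_congr rfl fun i _ => ?_
    rw [Finset.sum_comm, Finset.sum_eq_single i]
    · exact hdiag i _ _
    · intro b _ hb
      first
        | exact hne _ _ _ _ hb
        | exact hne _ _ _ _ hb.symm
    · simp
  · ext k l
    rw [Matrix.sum_apply]
    simp only [hR, ← Finset.smul_sum]
    rw [Finset.sum_comm]
    have h : ∀ j ∈ (Finset.univ : Finset (Fin d)),
        ∑ a, ∑ i : Fin m, P a (j, i, k) (j, i, l) = (m : ℂ) • (1 : Matrix (Fin n) (Fin n) L) k l := by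
      intro j _
      rw [Finset.sum_comm]
      have : ∀ i ∈ (Finset.univ : Finset (Fin m)), ∑ a, P a (j, i, k) (j, i, l)
          = (1 : Matrix (Fin n) (Fin n) L) k l := by
        intro i _
        rw [← Matrix.sum_apply, hPsum]
        simp [Matrix.one_apply]
      rw [Finset.sum_congr rfl this, Finset.sum_const,
        Finset.card_univ, Fintype.card_fin, ← Nat.cast_smul_eq_nsmul ℂ]
    rw [Finset.sum_congr rfl h, Finset.sum_const,
        Finset.card_univ, Fintype.card_fin, ← Nat.cast_smul_eq_nsmul ℂ, smul_smul, smul_smul,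
        Matrix.smul_apply]
    congr 1
    field_simp
end

section
/- Let N be a unital *-subalgebra of M_n(ℂ) and let u_1,…,u_d ∈ M_n(ℂ) be unitaries with u_i* N u_i = N for each i, forming an orthonormal Pimsner–Popa basis for M_n(ℂ) over N (i.e., E_N(u_i u_j*) = δ_{ij}·1 and x = Σ_i E_N(x u_i*) u_i for every x ∈ M_n(ℂ)). Then the operators P_i := (u_i* ⊗ 1_n)·e_N·(u_i ⊗ 1_n) ∈ M_n(ℂ)⊗M_n(ℂ) are self-adjoint projections with P_i P_j = 0 for i ≠ j and Σ_{i=1}^d P_i = 1, and they satisfy P_i·(x ⊗ 1_n)·P_i = 0 for every i and every x ∈ M_n(ℂ) with E_N(x) = 0. (This family is a local [M:N]-colouring of the quantum graph (M_n(ℂ), N', B(ℂ^n⊗ℂ^n)), proving χ_loc ≤ [M:N] = d.) -/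
open Matrix
open scoped Kronecker

open scoped ComplexOrder in
lemma eq_zero_of_trace_self (n : ℕ) (z : Matrix (Fin n) (Fin n) ℂ)
    (h : Matrix.trace (z * zᴴ) = 0) : z = 0 :=
  Matrix.trace_mul_conjTranspose_self_eq_zero_iff.mp h

open scoped ComplexOrder in
lemma eq_zero_of_dot_self (n : ℕ) (v : Fin n × Fin n → ℂ)
    (h : star v ⬝ᵥ v = 0) : v = 0 :=
  dotProduct_star_self_eq_zero.mp h

noncomputable def vecV (n : ℕ) (x : Matrix (Fin n) (Fin n) ℂ) : Fin n × Fin n → ℂ :=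
  (x ⊗ₖ (1 : Matrix (Fin n) (Fin n) ℂ)) *ᵥ psi n

lemma vecV_apply (n : ℕ) (x : Matrix (Fin n) (Fin n) ℂ) (p : Fin n × Fin n) :
    vecV n x p = x p.1 p.2 * (Real.sqrt n : ℂ)⁻¹ := by
  obtain ⟨i, j⟩ := p
  simp [vecV, psi, Matrix.mulVec, dotProduct, Fintype.sum_prod_type, Matrix.one_apply]

lemma vecV_surj (n : ℕ) (v : Fin n × Fin n → ℂ) : ∃ x, vecV n x = v := by
  refine ⟨Matrix.of fun i j => v (i, j) * (Real.sqrt n : ℂ), ?_⟩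
  funext p
  rw [vecV_apply]
  have hn : 0 < n := Fin.pos p.1
  have h : (Real.sqrt n : ℂ) ≠ 0 := by
    have : Real.sqrt n ≠ 0 := by positivity
    exact_mod_cast this
  simp [h]

lemma mat_ext_vecV (n : ℕ) {A B : Matrix (Fin n × Fin n) (Fin n × Fin n) ℂ}
    (h : ∀ x, A *ᵥ vecV n x = B *ᵥ vecV n x) : A = B := by
  apply Matrix.ext_of_mulVec_single
  intro k
  obtain ⟨x, hx⟩ := vecV_surj n (Pi.single k 1)
  rw [← hx, h]

lemma L_vecV (n : ℕ) (a x : Matrix (Fin n) (Fin n) ℂ) :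
    (a ⊗ₖ (1 : Matrix (Fin n) (Fin n) ℂ)) *ᵥ vecV n x = vecV n (a * x) := by
  simp [vecV, Matrix.mulVec_mulVec, ← Matrix.mul_kronecker_mul]

lemma vecV_sub (n : ℕ) (a x : Matrix (Fin n) (Fin n) ℂ) :
    vecV n (a - x) = vecV n a - vecV n x := by
  funext p
  simp [vecV_apply, sub_mul]

lemma vecV_sum (n d : ℕ) (f : Fin d → Matrix (Fin n) (Fin n) ℂ) :
    vecV n (∑ i, f i) = ∑ i, vecV n (f i) := by
  funext p
  simp [vecV_apply, Matrix.sum_apply, Finset.sum_mul]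

lemma vecV_inner (n : ℕ) (z x : Matrix (Fin n) (Fin n) ℂ) :
    star (vecV n z) ⬝ᵥ vecV n x
      = ((Real.sqrt n : ℂ)⁻¹ * (Real.sqrt n : ℂ)⁻¹) * Matrix.trace (x * zᴴ) := by
  simp only [dotProduct, Matrix.trace, Matrix.diag, Matrix.mul_apply, Fintype.sum_prod_type,
    Finset.mul_sum, Pi.star_apply, vecV_apply, Matrix.conjTranspose_apply]
  refine Finset.sum_congr rfl fun i _ => Finset.sum_congr rfl fun j _ => ?_
  simp
  ring

/-- An orthonormal Pimsner–Popa basis of unitaries normalising `N` yields a local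
`[M:N]`-colouring of the quantum graph `(Mₙ(ℂ), N', B(ℂⁿ⊗ℂⁿ))`: the
`Pᵢ = (uᵢ* ⊗ 1)e_N(uᵢ ⊗ 1)` form a PVM with `Pᵢ(x ⊗ 1)Pᵢ = 0` whenever `E_N(x) = 0`. -/
theorem normaliser_basis_gives_local_colouring (n : ℕ)
    (N : StarSubalgebra ℂ (Matrix (Fin n) (Fin n) ℂ))
    (E : Matrix (Fin n) (Fin n) ℂ →ₗ[ℂ] Matrix (Fin n) (Fin n) ℂ)
    (hEmem : ∀ x, E x ∈ N)
    (hEfix : ∀ y ∈ N, E y = y)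
    (hEtr : ∀ x, ∀ y ∈ N, Matrix.trace (E x * y) = Matrix.trace (x * y))
    (eN : Matrix (Fin n × Fin n) (Fin n × Fin n) ℂ)
    (heN_sa : eNᴴ = eN) (heN_idem : eN * eN = eN)
    (heN_fix : ∀ y ∈ N,
      eN *ᵥ ((y ⊗ₖ (1 : Matrix (Fin n) (Fin n) ℂ)) *ᵥ psi n)
        = (y ⊗ₖ (1 : Matrix (Fin n) (Fin n) ℂ)) *ᵥ psi n)
    (heN_ran : ∀ v : Fin n × Fin n → ℂ, ∃ y ∈ N,
      eN *ᵥ v = (y ⊗ₖ (1 : Matrix (Fin n) (Fin n) ℂ)) *ᵥ psi n)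
    (d : ℕ) (u : Fin d → Matrix (Fin n) (Fin n) ℂ)
    (hu : ∀ i, (u i)ᴴ * u i = 1)
    (huN : ∀ i, (fun y => (u i)ᴴ * y * u i) '' (N : Set (Matrix (Fin n) (Fin n) ℂ))
        = (N : Set (Matrix (Fin n) (Fin n) ℂ)))
    (horth : ∀ i j, E (u i * (u j)ᴴ) = if i = j then 1 else 0)
    (hbasis : ∀ x, x = ∑ i, E (x * (u i)ᴴ) * u i)
    (P : Fin d → Matrix (Fin n × Fin n) (Fin n × Fin n) ℂ)
    (hP : ∀ i, P i = ((u i)ᴴ ⊗ₖ (1 : Matrix (Fin n) (Fin n) ℂ)) * eN *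
        (u i ⊗ₖ (1 : Matrix (Fin n) (Fin n) ℂ))) :
    (∀ i, (P i)ᴴ = P i ∧ P i * P i = P i) ∧
    (∀ i j, i ≠ j → P i * P j = 0) ∧
    (∑ i, P i) = 1 ∧
    (∀ i, ∀ x : Matrix (Fin n) (Fin n) ℂ, E x = 0 →
      P i * (x ⊗ₖ (1 : Matrix (Fin n) (Fin n) ℂ)) * P i = 0) := by
  have uniq : ∀ a ∈ N, ∀ b ∈ N, (∀ y ∈ N, Matrix.trace (a * y) = Matrix.trace (b * y)) →
      a = b := by
    intro a ha b hb h
    have hz : a - b ∈ N := sub_mem ha hb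
    have hzs : (a - b)ᴴ ∈ N := star_mem hz
    have h1 : Matrix.trace ((a - b) * (a - b)ᴴ) = 0 := by
      rw [sub_mul a b, Matrix.trace_sub, h _ hzs, sub_self]
    exact sub_eq_zero.mp (eq_zero_of_trace_self n _ h1)
  have hEr : ∀ x, ∀ a ∈ N, E (x * a) = E x * a := by
    intro x a ha
    refine uniq _ (hEmem _) _ (mul_mem (hEmem _) ha) fun y hy => ?_
    rw [hEtr _ _ hy, mul_assoc, mul_assoc, hEtr _ _ (mul_mem ha hy)]
  have hEstar : ∀ x, E (xᴴ) = (E x)ᴴ := by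
    intro x
    refine uniq _ (hEmem _) _ (star_mem (hEmem x)) fun y hy => ?_
    have hys : yᴴ ∈ N := star_mem hy
    have h := congrArg star (hEtr x _ hys)
    rw [← Matrix.trace_conjTranspose, ← Matrix.trace_conjTranspose] at h
    simp only [Matrix.conjTranspose_mul, Matrix.conjTranspose_conjTranspose] at h
    rw [hEtr _ _ hy, Matrix.trace_mul_comm, Matrix.trace_mul_comm _ y]
    exact h.symm
  have heV : ∀ x, eN *ᵥ vecV n x = vecV n (E x) := by
    intro x
    obtain ⟨y, hy, hxy⟩ := heN_ran (vecV n x)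
    change _ = vecV n y at hxy
    have hz : y - E x ∈ N := sub_mem hy (hEmem x)
    have hzs : (y - E x)ᴴ ∈ N := star_mem hz
    have hfix : eN *ᵥ vecV n (y - E x) = vecV n (y - E x) := heN_fix _ hz
    have h1 : star (vecV n (y - E x)) ⬝ᵥ (eN *ᵥ vecV n x)
        = star (vecV n (y - E x)) ⬝ᵥ vecV n x := by
      rw [Matrix.dotProduct_mulVec]
      congr 1
      have h2 := congrArg star hfix
      rw [Matrix.star_mulVec, heN_sa] at h2
      exact h2
    have h3 : star (vecV n (y - E x)) ⬝ᵥ vecV n (y - E x) = 0 := by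
      rw [vecV_sub n y (E x), dotProduct_sub, ← vecV_sub, ← hxy, h1, vecV_inner, vecV_inner,
        hEtr _ _ hzs, sub_self]
    replace h3 := eq_zero_of_dot_self n _ h3
    rw [vecV_sub, sub_eq_zero] at h3
    rw [hxy, h3]
  have heLe : ∀ x, eN * (x ⊗ₖ (1 : Matrix (Fin n) (Fin n) ℂ)) * eN
      = (E x ⊗ₖ (1 : Matrix (Fin n) (Fin n) ℂ)) * eN := by
    intro x
    apply mat_ext_vecV
    intro y
    simp only [← Matrix.mulVec_mulVec, heV, L_vecV]
    rw [hEr _ _ (hEmem y)]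
  have hLL : ∀ a b : Matrix (Fin n) (Fin n) ℂ, (a ⊗ₖ (1 : Matrix (Fin n) (Fin n) ℂ)) *
      (b ⊗ₖ (1 : Matrix (Fin n) (Fin n) ℂ)) = (a * b) ⊗ₖ (1 : Matrix (Fin n) (Fin n) ℂ) := by
    intro a b
    rw [← Matrix.mul_kronecker_mul, one_mul]
  have key : ∀ i j (x : Matrix (Fin n) (Fin n) ℂ),
      P i * (x ⊗ₖ (1 : Matrix (Fin n) (Fin n) ℂ)) * P j
      = ((u i)ᴴ ⊗ₖ (1 : Matrix (Fin n) (Fin n) ℂ)) *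
        ((E (u i * x * (u j)ᴴ) ⊗ₖ (1 : Matrix (Fin n) (Fin n) ℂ)) * eN) *
        (u j ⊗ₖ (1 : Matrix (Fin n) (Fin n) ℂ)) := by
    intro i j x
    rw [← heLe, hP, hP, ← hLL, ← hLL]
    simp only [mul_assoc]
  have key1 : ∀ i j, P i * P j = ((u i)ᴴ ⊗ₖ (1 : Matrix (Fin n) (Fin n) ℂ)) *
        ((E (u i * (u j)ᴴ) ⊗ₖ (1 : Matrix (Fin n) (Fin n) ℂ)) * eN) *
        (u j ⊗ₖ (1 : Matrix (Fin n) (Fin n) ℂ)) := by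
    intro i j
    have := key i j 1
    rwa [Matrix.one_kronecker_one, mul_one, mul_one] at this
  refine ⟨fun i => ⟨?_, ?_⟩, fun i j hij => ?_, ?_, fun i x hx => ?_⟩
  · rw [hP]
    simp [Matrix.conjTranspose_mul, Matrix.conjTranspose_kronecker, heN_sa, mul_assoc]
  · rw [key1, horth, if_pos rfl, Matrix.one_kronecker_one, one_mul, ← hP]
  · rw [key1, horth, if_neg hij]
    simp
  · apply mat_ext_vecV
    intro x
    rw [Matrix.sum_mulVec, Matrix.one_mulVec]
    simp only [hP, ← Matrix.mulVec_mulVec, heV, L_vecV]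
    rw [← vecV_sum]
    congr 1
    have h := congrArg Matrix.conjTranspose (hbasis xᴴ)
    rw [Matrix.conjTranspose_conjTranspose, Matrix.conjTranspose_sum] at h
    conv_rhs => rw [h]
    refine Finset.sum_congr rfl fun i _ => ?_
    rw [Matrix.conjTranspose_mul, ← hEstar]
    simp [Matrix.conjTranspose_mul]
  · have h0 : E (u i * x * (u i)ᴴ) = 0 := by
      refine uniq _ (hEmem _) _ (zero_mem N) fun y hy => ?_
      have hm : (u i)ᴴ * y * u i ∈ N := by
        have : (u i)ᴴ * y * u i ∈ (N : Set (Matrix (Fin n) (Fin n) ℂ)) := by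
          rw [← huN i]
          exact ⟨y, hy, rfl⟩
        exact this
      rw [hEtr _ _ hy]
      have h2 := hEtr x _ hm
      rw [hx, zero_mul] at h2
      rw [zero_mul, h2, mul_assoc, mul_assoc, Matrix.trace_mul_comm]
      simp only [mul_assoc]
    rw [key, h0]
    simp
end
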